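/- arXiv:1808.01281 — 2 statements merged into one kernel-verified Lean document; each statement's English description precedes it below -/
import Mathlib

section
/- Every standard balanced tableau R on D(w) can be transformed into the super-Yamanouchi tableau by a sequence of exactly inv(R) Coxeter moves (commutation moves exchanging i and i+1 when in different rows and columns, and Yang–Baxter moves exchanging i−1 and i+1 when one is in the same column above i and the other in the same row right of i), and no shorter sequence of Coxeter moves suffices. -/
/-- The Coxeter length of `w`: the number of inversion pairs. -/
def invCount {n : ℕ} (w : Equiv.Perm (Fin n)) : ℕ :=
  (Finset.univ.filter fun p : Fin n × Fin n => p.1 < p.2 ∧ w p.2 < w p.1).card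

/-- The Rothe diagram of `w` (0-indexed): the cells `(i, w j)` for inversions `i < j`,
`w j < w i`, as a subset of `ℕ × ℕ` (first coordinate the row, drawn with row `0` at the
bottom so that "above" means larger first coordinate; second coordinate the column). -/
def RotheD (n : ℕ) (w : Equiv.Perm (Fin n)) : Finset (ℕ × ℕ) :=
  (Finset.univ.filter fun p : Fin n × Fin n => p.1 < p.2 ∧ w p.2 < w p.1).image
    fun p => ((p.1 : ℕ), (w p.2 : ℕ))

/-- A standard balanced tableau on a diagram `D`: a bijective filling of the cells of `D`
by `1, …, |D|` such that for every cell, the number of larger entries to its right in its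
row equals the number of smaller entries above it in its column. -/
def IsSBT (D : Finset (ℕ × ℕ)) (T : ℕ × ℕ → ℕ) : Prop :=
  Set.InjOn T ↑D ∧ D.image T = Finset.Icc 1 D.card ∧
  ∀ x ∈ D, (D.filter fun y => y.1 = x.1 ∧ x.2 < y.2 ∧ T x < T y).card
    = (D.filter fun y => y.2 = x.2 ∧ x.1 < y.1 ∧ T y < T x).card

/-- The inversion number of a tableau on `D`: the number of pairs of entries `i < j`
with `i` in a strictly higher row and a different column than `j`. -/
def invT (D : Finset (ℕ × ℕ)) (T : ℕ × ℕ → ℕ) : ℕ :=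
  ((D ×ˢ D).filter fun p => T p.1 < T p.2 ∧ p.2.1 < p.1.1 ∧ p.1.2 ≠ p.2.2).card


/-- The tableau `T` on `D` is super-Yamanouchi: its reverse row reading word (right to
left along rows, from the bottom row up) is the identity `1, 2, …, |D|`. -/
def IsSuperYT (D : Finset (ℕ × ℕ)) (T : ℕ × ℕ → ℕ) : Prop :=
  ∀ x ∈ D, ∀ y ∈ D, (T x < T y ↔ (x.1 < y.1 ∨ (x.1 = y.1 ∧ y.2 < x.2)))


/-- A Coxeter move on tableaux on `D`: either a commutation, exchanging entries `i` and
`i+1` lying in different rows and different columns, or a Yang–Baxter move, exchanging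
`i-1` and `i+1` when one of them lies in the same column above `i` and the other in the
same row to the right of `i`. -/
def CMoveT (D : Finset (ℕ × ℕ)) (T T' : ℕ × ℕ → ℕ) : Prop :=
  (∃ i : ℕ, ∃ x ∈ D, ∃ y ∈ D, T x = i ∧ T y = i + 1 ∧ x.1 ≠ y.1 ∧ x.2 ≠ y.2 ∧
    ∀ z, T' z = if T z = i then i + 1 else if T z = i + 1 then i else T z) ∨
  (∃ i : ℕ, 2 ≤ i ∧ ∃ x ∈ D, ∃ y ∈ D, ∃ z ∈ D, T x = i ∧
    ((T y = i - 1 ∧ T z = i + 1) ∨ (T y = i + 1 ∧ T z = i - 1)) ∧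
    y.2 = x.2 ∧ x.1 < y.1 ∧ z.1 = x.1 ∧ x.2 < z.2 ∧
    ∀ u, T' u = if T u = i - 1 then i + 1 else if T u = i + 1 then i - 1 else T u)

namespace CoxAux

variable {n : ℕ}

def RightS (w : Fin n → ℕ) (S : Fin n → Fin n → ℕ) (p q : Fin n) : Finset (Fin n) :=
  Finset.univ.filter fun k => p < k ∧ w q < w k ∧ w k < w p ∧ S p q < S p k

def UpS (w : Fin n → ℕ) (S : Fin n → Fin n → ℕ) (p q : Fin n) : Finset (Fin n) :=
  Finset.univ.filter fun k => p < k ∧ k < q ∧ w q < w k ∧ S k q < S p q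

def Bal (w : Fin n → ℕ) (S : Fin n → Fin n → ℕ) : Prop :=
  ∀ p q, p < q → w q < w p → (RightS w S p q).card = (UpS w S p q).card

def InjS (w : Fin n → ℕ) (S : Fin n → Fin n → ℕ) : Prop :=
  ∀ p q p' q', p < q → w q < w p → p' < q' → w q' < w p' → S p q = S p' q' → p = p' ∧ q = q'

def Loc (w : Fin n → ℕ) (S : Fin n → Fin n → ℕ) : Prop :=
  ∀ a b c : Fin n, a < b → b < c →
    (w b < w a → w c < w b →
      (S a b < S a c ∧ S a c < S b c) ∨ (S b c < S a c ∧ S a c < S a b)) ∧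
    (w c < w a → w b < w c → S a c < S a b) ∧
    (w a < w b → w c < w a → S a c < S b c)

lemma mem_RightS {w : Fin n → ℕ} {S : Fin n → Fin n → ℕ} {p q k : Fin n} :
    k ∈ RightS w S p q ↔ p < k ∧ w q < w k ∧ w k < w p ∧ S p q < S p k := by
  simp [RightS]

lemma mem_UpS {w : Fin n → ℕ} {S : Fin n → Fin n → ℕ} {p q k : Fin n} :
    k ∈ UpS w S p q ↔ p < k ∧ k < q ∧ w q < w k ∧ S k q < S p q := by
  simp [UpS]

/-- The minimal entry sits at an adjacent pair. -/
lemma adj_of_min {w : Fin n → ℕ} {S : Fin n → Fin n → ℕ} (hw : Function.Injective w)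
    (hb : Bal w S) {p q : Fin n} (hpq : p < q) (hwpq : w q < w p)
    (hi : InjS w S)
    (hmin : ∀ a b, a < b → w b < w a → S p q ≤ S a b) (r : Fin n) :
    ¬ (w q < w r ∧ w r < w p) := by
  intro hr
  have hU : UpS w S p q = ∅ := by
    ext k
    simp only [mem_UpS, Finset.notMem_empty, iff_false]
    rintro ⟨h1, h2, h3, h4⟩
    exact absurd (hmin k q h2 h3) (by omega)
  have hR : RightS w S p q = ∅ := by
    rw [← Finset.card_eq_zero, hb p q hpq hwpq, hU]; rfl
  have hge : ∀ k, p < k → w q < w k → w k < w p → False := by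
    intro k h1 h2 h3
    have h4 := hmin p k h1 h3
    have h5 : S p q ≠ S p k := by
      intro h
      have := (hi p q p k hpq hwpq h1 h3 h).2
      subst this; omega
    have : k ∈ RightS w S p q := mem_RightS.2 ⟨h1, h2, h3, by omega⟩
    rw [hR] at this; simp at this
  obtain ⟨r0, hr0, hr0m⟩ := Finset.exists_min_image
    (Finset.univ.filter fun r => w q < w r ∧ w r < w p) w ⟨r, by simpa using hr⟩
  simp only [Finset.mem_filter, Finset.mem_univ, true_and] at hr0 hr0m
  have hlt : r0 < p := by
    rcases lt_trichotomy r0 p with h | h | h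
    · exact h
    · subst h; omega
    · exact (hge r0 h hr0.1 hr0.2).elim
  have hR0 : RightS w S r0 q = ∅ := by
    ext k
    simp only [mem_RightS, Finset.notMem_empty, iff_false]
    rintro ⟨h1, h2, h3, h4⟩
    have := hr0m k ⟨h2, by omega⟩
    omega
  have h0 := hb r0 q (hlt.trans hpq) hr0.1
  rw [hR0] at h0
  have h1 : p ∈ UpS w S r0 q := by
    refine mem_UpS.2 ⟨hlt, hpq, hwpq, ?_⟩
    have h2 := hmin r0 q (hlt.trans hpq) hr0.1
    have h3 : S p q ≠ S r0 q := by
      intro h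
      have := (hi p q r0 q hpq hwpq (hlt.trans hpq) hr0.1 h).1
      subst this; exact lt_irrefl _ hlt
    omega
  have := Finset.card_pos.2 ⟨p, h1⟩
  simp at h0; omega

lemma col_of_min {w : Fin n → ℕ} {S : Fin n → Fin n → ℕ}
    (hw : Function.Injective w) (hb : Bal w S) {p q : Fin n} (hpq : p < q) (hwpq : w q < w p)
    (hi : InjS w S)
    (hmin : ∀ a b, a < b → w b < w a → S p q ≤ S a b)
    (hadj : ∀ r, ¬ (w q < w r ∧ w r < w p)) (i : Fin n) (hip : i < p) (hwi : w p < w i) :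
    S i q < S i p := by
  by_contra hcon
  have hne : ∀ i, i < p → w p < w i → S i q ≠ S i p := by
    intro i h1 h2 h
    have := (hi i q i p (h1.trans hpq) (by omega) h1 h2 h).2
    subst this; exact lt_irrefl _ hpq
  obtain ⟨j, hj, hjm⟩ := Finset.exists_max_image
    (Finset.univ.filter fun i => i < p ∧ w p < w i ∧ ¬ S i q < S i p) id
    ⟨i, by simpa using ⟨hip, hwi, by omega⟩⟩
  simp only [Finset.mem_filter, Finset.mem_univ, true_and, id] at hj hjm
  obtain ⟨hjp, hwj, hS⟩ := hj
  have hS' : S j p < S j q := by have := hne j hjp hwj; omega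
  have hb1 := hb j q (hjp.trans hpq) (by omega)
  have hb2 := hb j p hjp hwj
  have hsub1 : RightS w S j q ⊆ RightS w S j p := by
    intro k hk
    rw [mem_RightS] at hk ⊢
    obtain ⟨h1, h2, h3, h4⟩ := hk
    refine ⟨h1, ?_, h3, by omega⟩
    have h6 := hadj k
    by_contra h7
    have h8 : w k = w p := by omega
    have h9 : k = p := hw h8
    subst h9; omega
  have hsub2 : insert p (UpS w S j p) ⊆ UpS w S j q := by
    intro k hk
    rw [Finset.mem_insert, mem_UpS] at hk
    rw [mem_UpS]
    rcases hk with rfl | ⟨h1, h2, h3, h4⟩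
    · refine ⟨hjp, hpq, hwpq, ?_⟩
      have h2 := hmin j q (hjp.trans hpq) (by omega)
      have h3 : S k q ≠ S j q := by
        intro h
        have := (hi k q j q hpq hwpq (hjp.trans hpq) (by omega) h).1
        subst this; exact lt_irrefl _ hjp
      omega
    · refine ⟨h1, h2.trans hpq, by omega, ?_⟩
      have : S k q < S k p := by
        by_contra hc
        exact absurd (hjm k ⟨h2, h3, hc⟩) (not_le.2 h1)
      omega
  have hp : p ∉ UpS w S j p := by
    rw [mem_UpS]; rintro ⟨_, h, _⟩; exact lt_irrefl _ h
  have c1 := Finset.card_le_card hsub1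
  have c2 := Finset.card_le_card hsub2
  rw [Finset.card_insert_of_notMem hp] at c2
  omega

def sw (w : Fin n → ℕ) (p q : Fin n) : Fin n → ℕ := fun k => w (Equiv.swap p q k)

lemma sw_l (w : Fin n → ℕ) (p q : Fin n) : sw w p q p = w q := by simp [sw]
lemma sw_r (w : Fin n → ℕ) (p q : Fin n) : sw w p q q = w p := by simp [sw]
lemma sw_o (w : Fin n → ℕ) {p q k : Fin n} (h1 : k ≠ p) (h2 : k ≠ q) : sw w p q k = w k := by
  simp [sw, Equiv.swap_apply_of_ne_of_ne h1 h2]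

lemma inv_sw {w : Fin n → ℕ} (hw : Function.Injective w) {p q : Fin n} (hpq : p < q)
    (hwpq : w q < w p) (hadj : ∀ r, ¬ (w q < w r ∧ w r < w p)) (a b : Fin n) (hab : a < b) :
    sw w p q b < sw w p q a ↔ (w b < w a ∧ ¬ (a = p ∧ b = q)) := by
  have hl := sw_l w p q
  have hr := sw_r w p q
  have ho : ∀ k, k ≠ p → k ≠ q → sw w p q k = w k := fun k => sw_o w
  have hne : ∀ k l, k ≠ l → w k ≠ w l := fun k l h h' => h (hw h')
  have ha := hadj a
  have hb := hadj b
  by_cases a1 : a = p <;> by_cases a2 : a = q <;> by_cases b1 : b = p <;> by_cases b2 : b = q <;>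
    grind

lemma bal_sw {w : Fin n → ℕ} {S : Fin n → Fin n → ℕ} (hw : Function.Injective w)
    (hb : Bal w S) {p q : Fin n} (hpq : p < q) (hwpq : w q < w p)
    (hi : InjS w S)
    (hmin : ∀ a b, a < b → w b < w a → S p q ≤ S a b) : Bal (sw w p q) S := by
  have hadj := adj_of_min hw hb hpq hwpq hi hmin
  have hcol := col_of_min hw hb hpq hwpq hi hmin hadj
  have hl := sw_l w p q
  have hr := sw_r w p q
  have ho : ∀ k, k ≠ p → k ≠ q → sw w p q k = w k := fun k => sw_o w
  have hne : ∀ k l, k ≠ l → w k ≠ w l := fun k l h h' => h (hw h')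
  have hinv := inv_sw hw hpq hwpq hadj
  have hmin' : ∀ a b, a < b → w b < w a → ¬ (a = p ∧ b = q) → S p q < S a b := by
    intro a b h1 h2 h3
    have h4 := hmin a b h1 h2
    have h5 : S p q ≠ S a b := by
      intro h
      have := hi p q a b hpq hwpq h1 h2 h
      exact h3 ⟨this.1.symm, this.2.symm⟩
    omega
  intro i r hir hwir
  have hir' := (hinv i r hir).1 hwir
  have hbal := hb i r hir hir'.1
  by_cases hc : r = q ∧ i < p
  · obtain ⟨rfl, hip⟩ := hc
    have hwi : w p < w i := by
      have := hadj i
      have := hne i p hip.ne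
      omega
    have hU : UpS (sw w p r) S i r = (UpS w S i r).erase p := by
      ext k
      rw [Finset.mem_erase, mem_UpS, mem_UpS]
      have := hinv k r
      grind
    have hR : RightS (sw w p r) S i r = (RightS w S i r).erase p := by
      ext k
      rw [Finset.mem_erase, mem_RightS, mem_RightS]
      have := hinv i k
      have := hadj k
      have := hne k p
      have := hne k r
      grind
    have hpU : p ∈ UpS w S i r := by
      rw [mem_UpS]
      exact ⟨hip, hpq, hwpq, hmin' i r hir hir'.1 (fun h => hir'.2 h)⟩
    have hpR : p ∈ RightS w S i r := by
      rw [mem_RightS]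
      exact ⟨hip, hwpq, hwi, hcol i hip hwi⟩
    rw [hU, hR, Finset.card_erase_of_mem hpU, Finset.card_erase_of_mem hpR, hbal]
  · have hU : UpS (sw w p q) S i r = UpS w S i r := by
      ext k
      rw [mem_UpS, mem_UpS]
      have := hinv k r
      grind
    have hR : RightS (sw w p q) S i r = RightS w S i r := by
      ext k
      rw [mem_RightS, mem_RightS]
      have := hinv i k
      have := hadj k
      have := hadj r
      have := hne k r
      have := hne k p
      have := hne k q
      have := hne r p
      have := hne r q
      have := hmin' p r
      have := hcol i
      by_cases k1 : k = p <;> by_cases k2 : k = q <;> by_cases r1 : r = p <;>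
        by_cases r2 : r = q <;> grind
    rw [hU, hR, hbal]

theorem loc_of_bal (S : Fin n → Fin n → ℕ) : ∀ (N : ℕ) (w : Fin n → ℕ),
    (Finset.univ.filter fun p : Fin n × Fin n => p.1 < p.2 ∧ w p.2 < w p.1).card = N →
    Function.Injective w → Bal w S → InjS w S → Loc w S := by
  intro N
  induction N with
  | zero =>
    intro w hN hw hb hi a b c hab hbc
    rw [Finset.card_eq_zero] at hN
    have h : ∀ a b, a < b → ¬ w b < w a := by
      intro a b h1 h2
      have : (a, b) ∈ (Finset.univ.filter fun p : Fin n × Fin n => p.1 < p.2 ∧ w p.2 < w p.1) := by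
        simpa using ⟨h1, h2⟩
      rw [hN] at this; simp at this
    have h1 := h a b hab
    have h2 := h a c (hab.trans hbc)
    refine ⟨?_, ?_, ?_⟩ <;> intros <;> contradiction
  | succ N ih =>
    intro w hN hw hb hi
    obtain ⟨⟨p, q⟩, hm, hmin⟩ := Finset.exists_min_image
      (Finset.univ.filter fun p : Fin n × Fin n => p.1 < p.2 ∧ w p.2 < w p.1)
      (fun p => S p.1 p.2) (Finset.card_pos.1 (by omega))
    have hm' := hm
    simp only [Finset.mem_filter, Finset.mem_univ, true_and] at hm hmin
    obtain ⟨hpq, hwpq⟩ := hm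
    replace hmin : ∀ a b, a < b → w b < w a → S p q ≤ S a b :=
      fun a b h1 h2 => hmin (a, b) ⟨h1, h2⟩
    have hadj := adj_of_min hw hb hpq hwpq hi hmin
    have hinv := inv_sw hw hpq hwpq hadj
    have hl := sw_l w p q
    have hr := sw_r w p q
    have ho : ∀ k, k ≠ p → k ≠ q → sw w p q k = w k := fun k => sw_o w
    have hmin' : ∀ a b, a < b → w b < w a → ¬ (a = p ∧ b = q) → S p q < S a b := by
      intro a b h1 h2 h3
      have h4 := hmin a b h1 h2
      have h5 : S p q ≠ S a b := by
        intro h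
        have := hi p q a b hpq hwpq h1 h2 h
        exact h3 ⟨this.1.symm, this.2.symm⟩
      omega
    have hloc := ih (sw w p q) (by
        have : (Finset.univ.filter fun x : Fin n × Fin n =>
            x.1 < x.2 ∧ sw w p q x.2 < sw w p q x.1) =
            (Finset.univ.filter fun p : Fin n × Fin n => p.1 < p.2 ∧ w p.2 < w p.1).erase (p, q) := by
          ext ⟨a, b⟩
          simp only [Finset.mem_erase, Finset.mem_filter, Finset.mem_univ, true_and, ne_eq,
            Prod.mk.injEq]
          have := hinv a b
          grind
        rw [this, Finset.card_erase_of_mem hm', hN]; rfl)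
      (hw.comp (Equiv.swap p q).injective)
      (bal_sw hw hb hpq hwpq hi hmin)
      (by
        intro a b a' b' h1 h2 h3 h4
        exact hi a b a' b' h1 ((hinv a b h1).1 h2).1 h3 ((hinv a' b' h3).1 h4).1)
    have hne : ∀ k l, k ≠ l → w k ≠ w l := fun k l h h' => h (hw h')
    intro a b c hab hbc
    have hL := hloc a b c hab hbc
    have i1 := hinv a b hab
    have i2 := hinv a c (hab.trans hbc)
    have i3 := hinv b c hbc
    have m1 := hmin' a b hab
    have m2 := hmin' a c (hab.trans hbc)
    have m3 := hmin' b c hbc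
    have n1 := hne a b hab.ne
    have n2 := hne a c (hab.trans hbc).ne
    have n3 := hne b c hbc.ne
    have hswne : ∀ k l, k ≠ l → sw w p q k ≠ sw w p q l := fun k l h h' =>
      h ((hw.comp (Equiv.swap p q).injective) h')
    have n4 := hswne a b hab.ne
    have n5 := hswne a c (hab.trans hbc).ne
    have n6 := hswne b c hbc.ne
    clear hloc hmin hmin' hinv hadj hne hswne ih hN hm' hb hi hw ho hl hr
    refine ⟨?_, ?_, ?_⟩ <;> grind

end CoxAux

namespace CoxAux

lemma mem_Rothe {n : ℕ} {w : Equiv.Perm (Fin n)} {x : ℕ × ℕ} :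
    x ∈ RotheD n w ↔ ∃ p q : Fin n, p < q ∧ w q < w p ∧ x = ((p : ℕ), (w q : ℕ)) := by
  simp only [RotheD, Finset.mem_image, Finset.mem_filter, Finset.mem_univ, true_and, Prod.exists]
  constructor
  · rintro ⟨a, b, ⟨h1, h2⟩, h3⟩; exact ⟨a, b, h1, h2, h3.symm⟩
  · rintro ⟨a, b, h1, h2, h3⟩; exact ⟨a, b, ⟨h1, h2⟩, h3.symm⟩

lemma mem_Rothe' {n : ℕ} {w : Equiv.Perm (Fin n)} {p q : Fin n} :
    (((p : ℕ), (w q : ℕ)) : ℕ × ℕ) ∈ RotheD n w ↔ p < q ∧ w q < w p := by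
  rw [mem_Rothe]
  constructor
  · rintro ⟨a, b, h1, h2, h3⟩
    simp only [Prod.mk.injEq] at h3
    have e1 : p = a := Fin.ext h3.1
    have e2 : q = b := w.injective (Fin.ext h3.2)
    subst e1; subst e2; exact ⟨h1, h2⟩
  · rintro ⟨h1, h2⟩; exact ⟨p, q, h1, h2, rfl⟩

lemma loc_of_sbt {n : ℕ} {w : Equiv.Perm (Fin n)} {T : ℕ × ℕ → ℕ}
    (hT : IsSBT (RotheD n w) T) :
    Loc (fun k => (w k : ℕ)) (fun p q : Fin n => T ((p : ℕ), (w q : ℕ))) := by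
  obtain ⟨hinj, him, hbal⟩ := hT
  refine loc_of_bal _ _ _ rfl (fun a b h => w.injective (Fin.ext h)) ?_ ?_
  · intro p q hpq hwpq
    have h := hbal _ (mem_Rothe'.2 ⟨hpq, Fin.lt_def.2 hwpq⟩)
    have e1 : ((RotheD n w).filter fun y => y.1 = (p : ℕ) ∧ (w q : ℕ) < y.2 ∧
        T ((p : ℕ), (w q : ℕ)) < T y) =
        (RightS (fun k => (w k : ℕ)) (fun p q : Fin n => T ((p : ℕ), (w q : ℕ))) p q).image
          (fun k => ((p : ℕ), (w k : ℕ))) := by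
      ext ⟨a, b⟩
      simp only [Finset.mem_filter, Finset.mem_image, mem_RightS]
      constructor
      · rintro ⟨hD, h1, h2, h3⟩
        obtain ⟨p', q', h4, h5, h6⟩ := mem_Rothe.1 hD
        simp only [Prod.mk.injEq] at h6
        obtain ⟨rfl, rfl⟩ := h6
        have : p' = p := Fin.ext h1
        subst this
        exact ⟨q', ⟨h4, h2, h5, h3⟩, rfl⟩
      · rintro ⟨k, ⟨h1, h2, h3, h4⟩, h5⟩
        simp only [Prod.mk.injEq] at h5
        obtain ⟨rfl, rfl⟩ := h5
        exact ⟨mem_Rothe'.2 ⟨h1, h3⟩, rfl, h2, h4⟩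
    have e2 : ((RotheD n w).filter fun y => y.2 = (w q : ℕ) ∧ (p : ℕ) < y.1 ∧
        T y < T ((p : ℕ), (w q : ℕ))) =
        (UpS (fun k => (w k : ℕ)) (fun p q : Fin n => T ((p : ℕ), (w q : ℕ))) p q).image
          (fun k : Fin n => ((k : ℕ), (w q : ℕ))) := by
      ext ⟨a, b⟩
      simp only [Finset.mem_filter, Finset.mem_image, mem_UpS]
      constructor
      · rintro ⟨hD, h1, h2, h3⟩
        obtain ⟨p', q', h4, h5, h6⟩ := mem_Rothe.1 hD
        simp only [Prod.mk.injEq] at h6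
        obtain ⟨rfl, rfl⟩ := h6
        have : q' = q := w.injective (Fin.ext h1)
        subst this
        exact ⟨p', ⟨h2, h4, h5, h3⟩, rfl⟩
      · rintro ⟨k, ⟨h1, h2, h3, h4⟩, h5⟩
        simp only [Prod.mk.injEq] at h5
        obtain ⟨rfl, rfl⟩ := h5
        exact ⟨mem_Rothe'.2 ⟨h2, h3⟩, rfl, h1, h4⟩
    simp only at h
    rw [e1, e2, Finset.card_image_of_injective, Finset.card_image_of_injective] at h
    · exact h
    · intro a b h; simpa [Fin.ext_iff] using h
    · intro a b h; exact w.injective (Fin.ext (Prod.ext_iff.1 h).2)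
  · intro p q p' q' h1 h2 h3 h4 h
    have := hinj (mem_Rothe'.2 ⟨h1, Fin.lt_def.2 h2⟩) (mem_Rothe'.2 ⟨h3, Fin.lt_def.2 h4⟩) h
    simp only [Prod.mk.injEq] at this
    exact ⟨Fin.ext this.1, w.injective (Fin.ext this.2)⟩

/-- Consecutive entries `t` (above) and `t+1` in one column force a later entry in the lower row,
in a column further right. -/
lemma key1 {n : ℕ} {w : Fin n → ℕ} {S : Fin n → Fin n → ℕ} (hw : Function.Injective w)
    (hL : Loc w S) {i j q : Fin n} (hij : i < j) (hjq : j < q) (h1 : w q < w j) (h2 : w q < w i)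
    (hS : S j q < S i q) : w j < w i ∧ S i q < S i j := by
  have := hL i j q hij hjq
  have : w i ≠ w j := fun h => hij.ne (hw h)
  grind

lemma key2 {n : ℕ} {w : Fin n → ℕ} {S : Fin n → Fin n → ℕ} (hw : Function.Injective w)
    (hL : Loc w S) {i j q r : Fin n} {t : ℕ} (hij : i < j) (hjq : j < q) (hir : i < r)
    (h1 : w q < w j) (h2 : w q < w i) (h3 : w r < w i)
    (s1 : S j q = t) (s2 : S i q = t + 1) (s3 : S i r = t + 2)
    (hJ : j < r → w r < w j → S j r ≠ S i q) : w q < w r := by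
  obtain ⟨k1, k2⟩ := key1 hw hL hij hjq h1 h2 (by omega)
  by_contra hc
  have hqr : q ≠ r := by rintro rfl; omega
  have : w q ≠ w r := fun h => hqr (hw h)
  have hjr : j ≠ r := by rintro rfl; omega
  rcases lt_or_gt_of_ne hjr with h | h
  · have a1 := hL i j r hij h
    rcases lt_or_gt_of_ne hqr with h' | h'
    · have a2 := hL j q r hjq h'
      have a3 := hL i q r (hij.trans hjq) h'
      grind
    · have a2 := hL j r q h h'
      grind
  · have a1 := hL i r j hir h
    grind

/-- Effect of a commutation on hook comparisons and on the inversion set. -/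
def InvF (D : Finset (ℕ × ℕ)) (T : ℕ × ℕ → ℕ) : Finset ((ℕ × ℕ) × (ℕ × ℕ)) :=
  (D ×ˢ D).filter fun p => T p.1 < T p.2 ∧ p.2.1 < p.1.1 ∧ p.1.2 ≠ p.2.2

lemma mem_InvF {D : Finset (ℕ × ℕ)} {T : ℕ × ℕ → ℕ} {u v : ℕ × ℕ} :
    (u, v) ∈ InvF D T ↔ (u ∈ D ∧ v ∈ D) ∧ T u < T v ∧ v.1 < u.1 ∧ u.2 ≠ v.2 := by
  simp [InvF]

lemma move_inj {D : Finset (ℕ × ℕ)} {T T' : ℕ × ℕ → ℕ} (hi : Set.InjOn T ↑D)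
    (h : CMoveT D T T') : Set.InjOn T' ↑D := by
  have : ∃ a b, ∀ z, T' z = Equiv.swap a b (T z) := by
    rcases h with ⟨i, x, _, y, _, _, _, _, _, h⟩ | ⟨i, _, x, _, y, _, z, _, _, _, _, _, _, _, h⟩
    · exact ⟨i, i + 1, fun z => by rw [h, Equiv.swap_apply_def]⟩
    · exact ⟨i - 1, i + 1, fun z => by rw [h, Equiv.swap_apply_def]⟩
  obtain ⟨a, b, h⟩ := this
  intro u hu v hv huv
  rw [h, h] at huv
  exact hi hu hv ((Equiv.swap a b).injective huv)

lemma move_le {D : Finset (ℕ × ℕ)} {T T' : ℕ × ℕ → ℕ} (hi : Set.InjOn T ↑D)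
    (h : CMoveT D T T') : invT D T ≤ invT D T' + 1 := by
  have key : ∃ a, InvF D T ⊆ insert a (InvF D T') := by
    rcases h with ⟨i, x, hx, y, hy, h1, h2, h3, h4, h⟩ |
      ⟨i, hi2, x, hx, y, hy, z, hz, h1, h2, h3, h4, h5, h6, h⟩
    · refine ⟨(x, y), ?_⟩
      rintro ⟨u, v⟩ huv
      rw [Finset.mem_insert]
      rw [mem_InvF] at huv ⊢
      obtain ⟨⟨hu, hv⟩, a1, a2, a3⟩ := huv
      have e1 := @hi u hu x hx
      have e2 := @hi v hv y hy
      have := h u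
      have := h v
      grind
    · refine ⟨(y, z), ?_⟩
      rintro ⟨u, v⟩ huv
      rw [Finset.mem_insert]
      rw [mem_InvF] at huv ⊢
      obtain ⟨⟨hu, hv⟩, a1, a2, a3⟩ := huv
      have e1 := @hi u hu x hx
      have e2 := @hi v hv x hx
      have e3 := @hi u hu y hy
      have e4 := @hi v hv y hy
      have e5 := @hi u hu z hz
      have e6 := @hi v hv z hz
      have := h u
      have := h v
      grind
  obtain ⟨a, ha⟩ := key
  exact (Finset.card_le_card ha).trans (Finset.card_insert_le _ _)

lemma sbt_swap_aux {D : Finset (ℕ × ℕ)} {T T' : ℕ × ℕ → ℕ} (hT : IsSBT D T) (a b : ℕ)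
    (ha : a ∈ D.image T) (hb : b ∈ D.image T) (h : ∀ z, T' z = Equiv.swap a b (T z)) :
    D.image T' = Finset.Icc 1 D.card := by
  have : T' = (Equiv.swap a b) ∘ T := funext h
  rw [this, ← Finset.image_image, ← hT.2.1]
  ext v
  rw [Finset.mem_image]
  have key : ∀ c ∈ D.image T, Equiv.swap a b c ∈ D.image T := by
    intro c hc
    rw [Equiv.swap_apply_def]
    split_ifs <;> assumption
  constructor
  · rintro ⟨c, hc, rfl⟩; exact key c hc
  · intro hv; exact ⟨_, key v hv, by simp⟩

lemma comm_step {D : Finset (ℕ × ℕ)} {T : ℕ × ℕ → ℕ} (hT : IsSBT D T) {i : ℕ} {x y : ℕ × ℕ}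
    (hx : x ∈ D) (hy : y ∈ D) (h1 : T x = i) (h2 : T y = i + 1) (h3 : y.1 < x.1)
    (h4 : x.2 ≠ y.2) :
    ∃ T', CMoveT D T T' ∧ IsSBT D T' ∧ invT D T' < invT D T := by
  set T' : ℕ × ℕ → ℕ := fun z => if T z = i then i + 1 else if T z = i + 1 then i else T z with hT'
  have h : ∀ z, T' z = if T z = i then i + 1 else if T z = i + 1 then i else T z := fun z => rfl
  clear_value T'
  have hm : CMoveT D T T' := Or.inl ⟨i, x, hx, y, hy, h1, h2, h3.ne', h4, h⟩
  have hi := hT.1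
  refine ⟨T', hm, ⟨move_inj hT.1 hm, ?_, ?_⟩, ?_⟩
  · refine sbt_swap_aux hT i (i + 1) (Finset.mem_image.2 ⟨x, hx, h1⟩)
      (Finset.mem_image.2 ⟨y, hy, h2⟩) (fun z => by rw [h, Equiv.swap_apply_def])
  · have hc : ∀ u ∈ D, ∀ v ∈ D, (u.1 = v.1 ∨ u.2 = v.2) → (T' u < T' v ↔ T u < T v) := by
      intro u hu v hv huv
      have e1 := @hi u hu x hx
      have e2 := @hi v hv x hx
      have e3 := @hi u hu y hy
      have e4 := @hi v hv y hy
      have := h u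
      have := h v
      grind
    intro u hu
    have e1 : (D.filter fun y => y.1 = u.1 ∧ u.2 < y.2 ∧ T' u < T' y) =
        (D.filter fun y => y.1 = u.1 ∧ u.2 < y.2 ∧ T u < T y) := by
      apply Finset.filter_congr
      intro v hv
      have := hc u hu v hv
      grind
    have e2 : (D.filter fun y => y.2 = u.2 ∧ u.1 < y.1 ∧ T' y < T' u) =
        (D.filter fun y => y.2 = u.2 ∧ u.1 < y.1 ∧ T y < T u) := by
      apply Finset.filter_congr
      intro v hv
      have := hc v hv u hu
      grind
    rw [e1, e2]
    exact hT.2.2 u hu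
  · apply Finset.card_lt_card
    change InvF D T' ⊂ InvF D T
    rw [Finset.ssubset_iff_of_subset]
    · refine ⟨(x, y), ?_, ?_⟩
      · rw [mem_InvF]; exact ⟨⟨hx, hy⟩, by omega, h3, h4⟩
      · rw [mem_InvF]
        have := h x
        have := h y
        grind
    · rintro ⟨u, v⟩ huv
      rw [mem_InvF] at huv ⊢
      obtain ⟨⟨hu, hv⟩, a1, a2, a3⟩ := huv
      have e1 := @hi u hu y hy
      have e2 := @hi v hv x hx
      have := h u
      have := h v
      grind

lemma yb_step {D : Finset (ℕ × ℕ)} {T : ℕ × ℕ → ℕ} (hT : IsSBT D T) {i : ℕ} {x y z : ℕ × ℕ}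
    (hx : x ∈ D) (hy : y ∈ D) (hz : z ∈ D) (hi0 : 1 ≤ i)
    (t1 : T y = i) (t2 : T x = i + 1) (t3 : T z = i + 2)
    (h3 : y.2 = x.2) (h4 : x.1 < y.1) (h5 : z.1 = x.1) (h6 : x.2 < z.2) :
    ∃ T', CMoveT D T T' ∧ IsSBT D T' ∧ invT D T' < invT D T := by
  set T' : ℕ × ℕ → ℕ := fun z => if T z = i then i + 2 else if T z = i + 2 then i else T z with hT'
  have h : ∀ z, T' z = if T z = i then i + 2 else if T z = i + 2 then i else T z := fun z => rfl
  clear_value T'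
  have hm : CMoveT D T T' := Or.inr ⟨i + 1, by omega, x, hx, y, hy, z, hz, t2,
    Or.inl ⟨t1, t3⟩, h3, h4, h5, h6, fun u => h u⟩
  have hi := hT.1
  refine ⟨T', hm, ⟨move_inj hT.1 hm, ?_, ?_⟩, ?_⟩
  · refine sbt_swap_aux hT i (i + 2) (Finset.mem_image.2 ⟨y, hy, t1⟩)
      (Finset.mem_image.2 ⟨z, hz, t3⟩) (fun z => by rw [h, Equiv.swap_apply_def])
  · intro u hu
    by_cases hux : u = x
    · subst hux
      have e1 : (D.filter fun y => y.1 = u.1 ∧ u.2 < y.2 ∧ T' u < T' y) =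
          (D.filter fun y => y.1 = u.1 ∧ u.2 < y.2 ∧ T u < T y).erase z := by
        ext v
        rw [Finset.mem_erase, Finset.mem_filter, Finset.mem_filter]
        by_cases hv : v ∈ D
        · have e1 := @hi v hv u hx
          have e2 := @hi v hv y hy
          have e3 := @hi v hv z hz
          have := h u
          have := h v
          grind
        · simp [hv]
      have e2 : (D.filter fun y => y.2 = u.2 ∧ u.1 < y.1 ∧ T' y < T' u) =
          (D.filter fun y => y.2 = u.2 ∧ u.1 < y.1 ∧ T y < T u).erase y := by
        ext v
        rw [Finset.mem_erase, Finset.mem_filter, Finset.mem_filter]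
        by_cases hv : v ∈ D
        · have e1 := @hi v hv u hx
          have e2 := @hi v hv y hy
          have e3 := @hi v hv z hz
          have := h u
          have := h v
          grind
        · simp [hv]
      rw [e1, e2, Finset.card_erase_of_mem, Finset.card_erase_of_mem, hT.2.2 u hu]
      · rw [Finset.mem_filter]; exact ⟨hy, h3, h4, by omega⟩
      · rw [Finset.mem_filter]; exact ⟨hz, h5, h6, by omega⟩
    · have a1 := @hi u hu x hx
      have a2 := @hi u hu y hy
      have a3 := @hi u hu z hz
      have b1 := h u
      have e1 : (D.filter fun y => y.1 = u.1 ∧ u.2 < y.2 ∧ T' u < T' y) =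
          (D.filter fun y => y.1 = u.1 ∧ u.2 < y.2 ∧ T u < T y) := by
        apply Finset.filter_congr
        intro v hv
        have a4 := @hi v hv x hx
        have a5 := @hi v hv y hy
        have a6 := @hi v hv z hz
        have b2 := h v
        grind
      have e2 : (D.filter fun y => y.2 = u.2 ∧ u.1 < y.1 ∧ T' y < T' u) =
          (D.filter fun y => y.2 = u.2 ∧ u.1 < y.1 ∧ T y < T u) := by
        apply Finset.filter_congr
        intro v hv
        have a4 := @hi v hv x hx
        have a5 := @hi v hv y hy
        have a6 := @hi v hv z hz
        have b2 := h v
        grind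
      rw [e1, e2]
      exact hT.2.2 u hu
  · apply Finset.card_lt_card
    change InvF D T' ⊂ InvF D T
    rw [Finset.ssubset_iff_of_subset]
    · refine ⟨(y, z), ?_, ?_⟩
      · rw [mem_InvF]; exact ⟨⟨hy, hz⟩, by omega, by omega, by omega⟩
      · rw [mem_InvF]
        have := h y
        have := h z
        grind
    · rintro ⟨u, v⟩ huv
      rw [mem_InvF] at huv ⊢
      obtain ⟨⟨hu, hv⟩, a1, a2, a3⟩ := huv
      have e1 := @hi u hu x hx
      have e2 := @hi v hv x hx
      have e3 := @hi u hu y hy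
      have e4 := @hi v hv y hy
      have e5 := @hi u hu z hz
      have e6 := @hi v hv z hz
      have := h u
      have := h v
      grind

lemma super_inv {D : Finset (ℕ × ℕ)} {T : ℕ × ℕ → ℕ} (h : IsSuperYT D T) : invT D T = 0 := by
  change (InvF D T).card = 0
  rw [Finset.card_eq_zero]
  ext ⟨u, v⟩
  rw [mem_InvF]
  simp only [Finset.notMem_empty, iff_false]
  rintro ⟨⟨hu, hv⟩, a1, a2, a3⟩
  have := (h u hu v hv).1 a1
  omega

lemma inv_zero_super {D : Finset (ℕ × ℕ)} {T : ℕ × ℕ → ℕ} (hT : IsSBT D T)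
    (h : invT D T = 0) : IsSuperYT D T := by
  change (InvF D T).card = 0 at h
  rw [Finset.card_eq_zero] at h
  have h0 : ∀ u ∈ D, ∀ v ∈ D, T u < T v → v.1 < u.1 → u.2 = v.2 := by
    intro u hu v hv a1 a2
    by_contra a3
    have : (u, v) ∈ InvF D T := mem_InvF.2 ⟨⟨hu, hv⟩, a1, a2, a3⟩
    rw [h] at this; simp at this
  have h1 : ∀ u ∈ D, ∀ v ∈ D, v.1 < u.1 → ¬ T u < T v := by
    intro u hu v hv a2 a1
    have a3 := h0 u hu v hv a1 a2
    have hb := hT.2.2 v hv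
    have : u ∈ D.filter fun y => y.2 = v.2 ∧ v.1 < y.1 ∧ T y < T v :=
      Finset.mem_filter.2 ⟨hu, a3, a2, a1⟩
    have hp := Finset.card_pos.2 ⟨u, this⟩
    rw [← hb] at hp
    obtain ⟨z, hz⟩ := Finset.card_pos.1 hp
    rw [Finset.mem_filter] at hz
    obtain ⟨hz, b1, b2, b3⟩ := hz
    have := h0 u hu z hz (by omega) (by omega)
    omega
  have h2 : ∀ u ∈ D, ∀ v ∈ D, v.1 = u.1 → u.2 < v.2 → ¬ T u < T v := by
    intro u hu v hv a1 a2 a3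
    have hb := hT.2.2 u hu
    have : v ∈ D.filter fun y => y.1 = u.1 ∧ u.2 < y.2 ∧ T u < T y :=
      Finset.mem_filter.2 ⟨hv, a1, a2, a3⟩
    have hp := Finset.card_pos.2 ⟨v, this⟩
    rw [hb] at hp
    obtain ⟨z, hz⟩ := Finset.card_pos.1 hp
    rw [Finset.mem_filter] at hz
    exact h1 z hz.1 u hu hz.2.2.1 hz.2.2.2
  intro x hx y hy
  by_cases hxy : x = y
  · subst hxy; simp
  have hne : T x ≠ T y := fun h => hxy (hT.1 hx hy h)
  have hne' : ¬ (x.1 = y.1 ∧ x.2 = y.2) := fun h => hxy (Prod.ext h.1 h.2)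
  have a1 := h1 x hx y hy
  have a2 := h1 y hy x hx
  have a3 := h2 x hx y hy
  have a4 := h2 y hy x hx
  omega

lemma exists_step {n : ℕ} {w : Equiv.Perm (Fin n)} {T : ℕ × ℕ → ℕ}
    (hT : IsSBT (RotheD n w) T) (hpos : invT (RotheD n w) T ≠ 0) :
    ∃ T', CMoveT (RotheD n w) T T' ∧ IsSBT (RotheD n w) T' ∧
      invT (RotheD n w) T' < invT (RotheD n w) T := by
  have hLoc := loc_of_sbt hT
  have hwinj : Function.Injective (fun k => (w k : ℕ)) := fun a b h => w.injective (Fin.ext h)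
  generalize hD : RotheD n w = D at *
  have him := hT.2.1
  have hg : ∀ v : ℕ, ∃ x : ℕ × ℕ, 1 ≤ v → v ≤ D.card → x ∈ D ∧ T x = v := by
    intro v
    by_cases hv : v ∈ D.image T
    · obtain ⟨x, hx, h⟩ := Finset.mem_image.1 hv
      exact ⟨x, fun _ _ => ⟨hx, h⟩⟩
    · refine ⟨0, fun h1 h2 => ?_⟩
      rw [him, Finset.mem_Icc] at hv
      exact absurd ⟨h1, h2⟩ hv
  choose g hg using hg
  have hgT : ∀ x ∈ D, g (T x) = x ∧ 1 ≤ T x ∧ T x ≤ D.card := by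
    intro x hx
    have : T x ∈ Finset.Icc 1 D.card := him ▸ Finset.mem_image_of_mem T hx
    rw [Finset.mem_Icc] at this
    have h2 := hg (T x) this.1 this.2
    exact ⟨hT.1 h2.1 hx h2.2, this⟩
  have mono : ∀ m, 1 ≤ m → (∀ v, m ≤ v → v < D.card → (g v).1 ≤ (g (v + 1)).1) →
      ∀ a b, m ≤ a → a ≤ b → b ≤ D.card → (g a).1 ≤ (g b).1 := by
    intro m hm hstep a b ha hab
    induction b, hab using Nat.le_induction with
    | base => intro _; exact le_rfl
    | succ b hb ih =>
      intro hc
      exact (ih (by omega)).trans (hstep b (by omega) (by omega))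
  have hne : ((Finset.Icc 1 (D.card - 1)).filter fun v => (g (v + 1)).1 < (g v).1).Nonempty := by
    by_contra hcon
    rw [Finset.not_nonempty_iff_eq_empty] at hcon
    apply hpos
    change (InvF D T).card = 0
    rw [Finset.card_eq_zero]
    ext ⟨u, v⟩
    rw [mem_InvF]
    simp only [Finset.notMem_empty, iff_false]
    rintro ⟨⟨hu, hv⟩, a1, a2, a3⟩
    have hm := mono 1 le_rfl (by
      intro v h1 h2
      by_contra hc
      have : v ∈ ((Finset.Icc 1 (D.card - 1)).filter fun v => (g (v + 1)).1 < (g v).1) := by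
        rw [Finset.mem_filter, Finset.mem_Icc]
        exact ⟨⟨h1, by omega⟩, by omega⟩
      rw [hcon] at this; simp at this) (T u) (T v) (hgT u hu).2.1 a1.le (hgT v hv).2.2
    rw [(hgT u hu).1, (hgT v hv).1] at hm
    omega
  obtain ⟨i, him', hmax⟩ := Finset.exists_max_image _ id hne
  simp only [Finset.mem_filter, Finset.mem_Icc, id] at him' hmax
  obtain ⟨⟨hi1, hi2⟩, hdesc⟩ := him'
  have hm := mono (i + 1) (by omega) (by
    intro v h1 h2
    by_contra hc
    have := hmax v ⟨⟨by omega, by omega⟩, by omega⟩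
    omega)
  obtain ⟨hyD, hyT⟩ := hg i hi1 (by omega)
  obtain ⟨hxD, hxT⟩ := hg (i + 1) (by omega) (by omega)
  by_cases hcol : (g i).2 = (g (i + 1)).2
  · -- Yang-Baxter case
    obtain ⟨j, q, hjq, hwjq, ey⟩ := mem_Rothe.1 (hD ▸ hyD)
    obtain ⟨i0, q', hiq, hwiq, ex⟩ := mem_Rothe.1 (hD ▸ hxD)
    rw [ex, ey] at hcol hdesc
    simp only at hcol hdesc
    have : q = q' := w.injective (Fin.ext hcol)
    subst this
    have hij : i0 < j := hdesc
    rw [ey] at hyT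
    rw [ex] at hxT
    obtain ⟨k1, k2⟩ := key1 hwinj hLoc hij hjq hwjq hwiq (by omega)
    have hzD : ((i0 : ℕ), (w j : ℕ)) ∈ D := hD ▸ mem_Rothe'.2 ⟨hij, k1⟩
    have hz := hgT _ hzD
    have hle : i + 2 ≤ T ((i0 : ℕ), (w j : ℕ)) := by omega
    have m1 := hm (i + 1) (i + 2) (by omega) (by omega) (by omega)
    have m2 := hm (i + 2) _ (by omega) hle (by omega)
    rw [hz.1] at m2
    rw [ex] at m1
    simp only at m1 m2
    obtain ⟨huD, huT⟩ := hg (i + 2) (by omega) (by omega)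
    obtain ⟨i1, r, hir, hwir, eu⟩ := mem_Rothe.1 (hD ▸ huD)
    rw [eu] at m1 m2 huT
    simp only at m1 m2
    have : i1 = i0 := Fin.ext (by omega)
    subst this
    have k3 := key2 hwinj hLoc hij hjq hir hwjq hwiq hwir hyT hxT huT (by
      intro b1 b2 b3
      have := hT.1 (hD ▸ mem_Rothe'.2 ⟨b1, b2⟩) (hD ▸ mem_Rothe'.2 ⟨hiq, hwiq⟩) b3
      simp only [Prod.mk.injEq] at this
      omega)
    rw [ex] at hxD
    rw [ey] at hyD
    rw [eu] at huD
    exact yb_step hT hxD hyD huD hi1 hyT hxT huT rfl hij rfl k3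
  · exact comm_step hT hyD hxD hyT hxT hdesc hcol

lemma exists_path {n : ℕ} {w : Equiv.Perm (Fin n)} : ∀ (N : ℕ) (T : ℕ × ℕ → ℕ),
    IsSBT (RotheD n w) T → invT (RotheD n w) T = N →
    ∃ f : ℕ → (ℕ × ℕ → ℕ), f 0 = T ∧ (∀ k < N, CMoveT (RotheD n w) (f k) (f (k + 1))) ∧
      IsSuperYT (RotheD n w) (f N) := by
  intro N
  induction N with
  | zero =>
    intro T hT h
    exact ⟨fun _ => T, rfl, by simp, inv_zero_super hT h⟩
  | succ N ih =>
    intro T hT h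
    obtain ⟨T', hm, hT', hlt⟩ := exists_step hT (by omega)
    have := move_le hT.1 hm
    obtain ⟨f, f0, f1, f2⟩ := ih T' hT' (by omega)
    refine ⟨fun k => Nat.casesOn k T f, rfl, ?_, f2⟩
    intro k hk
    cases k with
    | zero => simpa [f0] using hm
    | succ k => exact f1 k (by omega)

lemma path_le {D : Finset (ℕ × ℕ)} : ∀ (m : ℕ) (f : ℕ → (ℕ × ℕ → ℕ)), Set.InjOn (f 0) ↑D →
    (∀ k < m, CMoveT D (f k) (f (k + 1))) →
    Set.InjOn (f m) ↑D ∧ invT D (f 0) ≤ invT D (f m) + m := by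
  intro m f h0
  induction m with
  | zero => intro _; exact ⟨h0, le_rfl⟩
  | succ m ih =>
    intro h
    obtain ⟨h1, h2⟩ := ih (fun k hk => h k (by omega))
    have hm := h m (by omega)
    exact ⟨move_inj h1 hm, by have := move_le h1 hm; omega⟩

end CoxAux

/-- Every standard balanced tableau `R` can be brought to the super-Yamanouchi tableau
by a sequence of exactly `inv R` Coxeter moves, and no shorter sequence suffices. -/
theorem coxeter_distance_to_superYamanouchi (n : ℕ) (w : Equiv.Perm (Fin n))
    (T : ℕ × ℕ → ℕ) (hT : IsSBT (RotheD n w) T) :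
    (∃ f : ℕ → (ℕ × ℕ → ℕ), f 0 = T ∧
      (∀ k < invT (RotheD n w) T, CMoveT (RotheD n w) (f k) (f (k + 1))) ∧
      IsSuperYT (RotheD n w) (f (invT (RotheD n w) T))) ∧
    (∀ m : ℕ, ∀ f : ℕ → (ℕ × ℕ → ℕ), f 0 = T →
      (∀ k < m, CMoveT (RotheD n w) (f k) (f (k + 1))) →
      IsSuperYT (RotheD n w) (f m) → invT (RotheD n w) T ≤ m) := by
  refine ⟨CoxAux.exists_path _ T hT rfl, ?_⟩
  intro m f f0 hm hs
  have h := (CoxAux.path_le m f (f0 ▸ hT.1) hm).2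
  rw [CoxAux.super_inv hs, f0] at h
  omega
end

section
/- The maximal distance in the Coxeter-move graph between two standard balanced tableaux on the staircase diagram (equivalently, between two reduced words for the longest permutation of S_n) equals (n−2)(n−1)n(3n−5)/24. -/
namespace CoxDiam

/-- The staircase diagram. -/
abbrev St (n : ℕ) : Finset (ℕ × ℕ) := RotheD n (Fin.revPerm : Equiv.Perm (Fin n))

lemma mem_St {n : ℕ} {x : ℕ × ℕ} : x ∈ St n ↔ x.1 + x.2 + 1 < n := by
  obtain ⟨i, c⟩ := x
  simp only [St, RotheD, Finset.mem_image, Finset.mem_filter, Finset.mem_univ, true_and,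
    Prod.exists, Prod.mk.injEq, Fin.revPerm_apply]
  constructor
  · rintro ⟨a, b, ⟨h1, h2⟩, h3, h4⟩
    have := a.2
    have := b.2
    rw [Fin.val_rev] at h4
    rw [Fin.lt_def] at h1
    omega
  · intro h
    refine ⟨⟨i, by omega⟩, ⟨n - 1 - c, by omega⟩, ⟨?_, ?_⟩, rfl, ?_⟩
    · rw [Fin.lt_def]; simp only; omega
    · rw [Fin.lt_def, Fin.val_rev, Fin.val_rev]; simp only; omega
    · rw [Fin.val_rev]; simp only; omega

/-- The cell of the pair `(i, j)`. -/
def cell (n i j : ℕ) : ℕ × ℕ := (i, n - 1 - j)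

lemma cell_mem {n i j : ℕ} (h : i < j) (h' : j < n) : cell n i j ∈ St n := by
  rw [mem_St]; simp only [cell]; omega

lemma exists_cell {n : ℕ} {x : ℕ × ℕ} (h : x ∈ St n) :
    ∃ i j, i < j ∧ j < n ∧ x = cell n i j := by
  rw [mem_St] at h
  refine ⟨x.1, n - 1 - x.2, by omega, by omega, ?_⟩
  ext <;> simp only [cell]
  omega

lemma cell_inj {n i j i' j' : ℕ} (h : j < n) (h' : j' < n) (e : cell n i j = cell n i' j') :
    i = i' ∧ j = j' := by
  simp only [cell, Prod.mk.injEq] at e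
  omega

/-- Betweenness (the total reflection order condition). -/
def Btw (n : ℕ) (T : ℕ × ℕ → ℕ) : Prop :=
  ∀ i k j, i < k → k < j → j < n →
    (T (cell n i k) < T (cell n i j) ∧ T (cell n i j) < T (cell n k j)) ∨
    (T (cell n k j) < T (cell n i j) ∧ T (cell n i j) < T (cell n i k))

lemma card_row {n i j : ℕ} (hij : i < j) (hj : j < n) (T : ℕ × ℕ → ℕ) :
    ((St n).filter fun y => y.1 = (cell n i j).1 ∧ (cell n i j).2 < y.2 ∧
      T (cell n i j) < T y).card =
    ((Finset.Ioo i j).filter fun k => T (cell n i j) < T (cell n i k)).card := by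
  symm
  apply Finset.card_bij (fun k _ => cell n i k)
  · intro k hk
    simp only [Finset.mem_filter, Finset.mem_Ioo] at hk ⊢
    refine ⟨cell_mem hk.1.1 (by omega), rfl, ?_, hk.2⟩
    simp only [cell]; omega
  · intro a ha b hb e
    simp only [Finset.mem_filter, Finset.mem_Ioo] at ha hb
    exact (cell_inj (by omega) (by omega) e).2
  · intro y hy
    simp only [Finset.mem_filter] at hy
    obtain ⟨a, b, h1, h2, rfl⟩ := exists_cell hy.1
    obtain ⟨_, h3, h4, h5⟩ := hy
    simp only [cell] at h3 h4
    subst h3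
    refine ⟨b, ?_, rfl⟩
    simp only [Finset.mem_filter, Finset.mem_Ioo]
    exact ⟨⟨h1, by omega⟩, h5⟩

lemma card_col {n i j : ℕ} (hij : i < j) (hj : j < n) (T : ℕ × ℕ → ℕ) :
    ((St n).filter fun y => y.2 = (cell n i j).2 ∧ (cell n i j).1 < y.1 ∧
      T y < T (cell n i j)).card =
    ((Finset.Ioo i j).filter fun k => T (cell n k j) < T (cell n i j)).card := by
  symm
  apply Finset.card_bij (fun k _ => cell n k j)
  · intro k hk
    simp only [Finset.mem_filter, Finset.mem_Ioo] at hk ⊢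
    exact ⟨cell_mem hk.1.2 (by omega), rfl, hk.1.1, hk.2⟩
  · intro a ha b hb e
    exact (cell_inj hj hj e).1
  · intro y hy
    simp only [Finset.mem_filter] at hy
    obtain ⟨a, b, h1, h2, rfl⟩ := exists_cell hy.1
    obtain ⟨_, h3, h4, h5⟩ := hy
    simp only [cell] at h3 h4
    have : b = j := by omega
    subst this
    refine ⟨a, ?_, rfl⟩
    simp only [Finset.mem_filter, Finset.mem_Ioo]
    exact ⟨⟨h4, h1⟩, h5⟩

/-- Valid tableaux. -/
def Val (n : ℕ) (T : ℕ × ℕ → ℕ) : Prop :=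
  Set.InjOn T ↑(St n) ∧ (St n).image T = Finset.Icc 1 (St n).card ∧ Btw n T

lemma ne_of_ne {n : ℕ} {T : ℕ × ℕ → ℕ} (hT : Set.InjOn T ↑(St n)) {i j i' j' : ℕ}
    (h1 : i < j) (h2 : j < n) (h3 : i' < j') (h4 : j' < n) (h : T (cell n i j) = T (cell n i' j')) :
    i = i' ∧ j = j' :=
  cell_inj h2 h4 (hT (Finset.mem_coe.2 (cell_mem h1 h2)) (Finset.mem_coe.2 (cell_mem h3 h4)) h)

lemma btw_of_bal {n : ℕ} {T : ℕ × ℕ → ℕ} (hT : IsSBT (St n) T) : Btw n T := by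
  obtain ⟨hinj, -, hb⟩ := hT
  have key : ∀ d i k j, j - i = d → i < k → k < j → j < n →
    (T (cell n i k) < T (cell n i j) ∧ T (cell n i j) < T (cell n k j)) ∨
    (T (cell n k j) < T (cell n i j) ∧ T (cell n i j) < T (cell n i k)) := by
    intro d
    induction d using Nat.strong_induction_on with
    | _ d ih =>
    intro i k0 j hd hik hkj hj
    have hij : i < j := by omega
    have hc := hb _ (cell_mem hij hj)
    rw [card_row hij hj, card_col hij hj] at hc
    set A := (Finset.Ioo i j).filter fun k => T (cell n i j) < T (cell n i k) with hA
    set B := (Finset.Ioo i j).filter fun k => T (cell n k j) < T (cell n i j) with hB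
    have hAB : A = B := by
      by_contra hne
      have h1 : ¬ A ⊆ B := fun h => hne (Finset.eq_of_subset_of_card_le h hc.ge)
      have h2 : ¬ B ⊆ A := fun h => hne (Finset.eq_of_subset_of_card_le h hc.le).symm
      rw [Finset.not_subset] at h1 h2
      obtain ⟨k, hkA, hkB⟩ := h1
      obtain ⟨l, hlB, hlA⟩ := h2
      simp only [hA, hB, Finset.mem_filter, Finset.mem_Ioo, not_and, not_lt] at hkA hkB hlA hlB
      have hkB := hkB hkA.1
      have hlA := hlA hlB.1
      obtain ⟨⟨a1, a2⟩, a3⟩ := hkA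
      obtain ⟨⟨b1, b2⟩, b3⟩ := hlB
      rcases lt_trichotomy k l with h | h | h
      · have e1 := ih (l - i) (by omega) i k l rfl a1 h (by omega)
        have e2 := ih (j - k) (by omega) k l j rfl h b2 hj
        omega
      · subst h; omega
      · have e1 := ih (k - i) (by omega) i l k rfl b1 h (by omega)
        have e2 := ih (j - l) (by omega) l k j rfl h a2 hj
        omega
    have hmem : k0 ∈ A ↔ k0 ∈ B := by rw [hAB]
    simp only [hA, hB, Finset.mem_filter, Finset.mem_Ioo, hik, hkj, true_and] at hmem
    have n1 : T (cell n i k0) ≠ T (cell n i j) := fun h => by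
      have := ne_of_ne hinj hik (by omega) hij hj h
      omega
    have n2 : T (cell n k0 j) ≠ T (cell n i j) := fun h => by
      have := ne_of_ne hinj hkj (by omega) hij hj h
      omega
    omega
  intro i k j
  exact key _ i k j rfl

lemma val_of_sbt {n : ℕ} {T : ℕ × ℕ → ℕ} (hT : IsSBT (St n) T) : Val n T :=
  ⟨hT.1, hT.2.1, btw_of_bal hT⟩

lemma sbt_of_val {n : ℕ} {T : ℕ × ℕ → ℕ} (hT : Val n T) : IsSBT (St n) T := by
  refine ⟨hT.1, hT.2.1, ?_⟩
  intro x hx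
  obtain ⟨i, j, hij, hj, rfl⟩ := exists_cell hx
  rw [card_row hij hj, card_col hij hj]
  congr 1
  apply Finset.filter_congr
  intro k hk
  rw [Finset.mem_Ioo] at hk
  have := hT.2.2 i k j hk.1 hk.2 hj
  omega

/-- The inversion set relative to the lexicographic order. -/
def invS (n : ℕ) (T : ℕ × ℕ → ℕ) : Finset ((ℕ × ℕ) × (ℕ × ℕ)) :=
  (St n ×ˢ St n).filter fun P => P.1.1 < P.2.1 ∧ P.1.2 ≠ P.2.2 ∧ T P.2 < T P.1

/-- Transposition of two values. -/
def sw (u v w : ℕ) : ℕ := if w = u then v else if w = v then u else w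

lemma val_sw {n : ℕ} {T T' : ℕ × ℕ → ℕ} (hT : Val n T) {p q : ℕ × ℕ} (hp : p ∈ St n)
    (hq : q ∈ St n) (h : ∀ z ∈ St n, T' z = sw (T p) (T q) (T z)) :
    Set.InjOn T' ↑(St n) ∧ (St n).image T' = Finset.Icc 1 (St n).card := by
  have hinj : Set.InjOn T' ↑(St n) := by
    intro x hx y hy e
    apply hT.1 hx hy
    rw [h x hx, h y hy] at e
    unfold sw at e
    split_ifs at e <;> omega
  refine ⟨hinj, ?_⟩
  apply Finset.eq_of_subset_of_card_le
  · intro w hw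
    rw [Finset.mem_image] at hw
    obtain ⟨z, hz, rfl⟩ := hw
    have hm : ∀ z ∈ St n, T z ∈ Finset.Icc 1 (St n).card := fun z hz => by
      rw [← hT.2.1]; exact Finset.mem_image_of_mem _ hz
    rw [h z hz]
    unfold sw
    split_ifs
    · exact hm _ hq
    · exact hm _ hp
    · exact hm _ hz
  · rw [Finset.card_image_of_injOn hinj]; simp

/-- Commutations preserve validity and all but one relative order. -/
lemma comm_step {n : ℕ} {T T' : ℕ × ℕ → ℕ} (hT : Val n T) {p q : ℕ × ℕ} (hp : p ∈ St n)
    (hq : q ∈ St n) (hpq : T q = T p + 1) (h1 : p.1 ≠ q.1) (h2 : p.2 ≠ q.2)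
    (h : ∀ z ∈ St n, T' z = sw (T p) (T q) (T z)) :
    Val n T' ∧ ∀ x ∈ St n, ∀ y ∈ St n, (T' x < T' y ↔ T x < T y) ∨ (x = p ∧ y = q) ∨
      (x = q ∧ y = p) := by
  have key : ∀ x ∈ St n, ∀ y ∈ St n, (T' x < T' y ↔ T x < T y) ∨ (x = p ∧ y = q) ∨
      (x = q ∧ y = p) := by
    intro x hx y hy
    have e1 : T x = T p → x = p := fun e => hT.1 hx hp e
    have e2 : T x = T q → x = q := fun e => hT.1 hx hq e
    have e3 : T y = T p → y = p := fun e => hT.1 hy hp e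
    have e4 : T y = T q → y = q := fun e => hT.1 hy hq e
    rw [h x hx, h y hy]
    unfold sw
    split_ifs <;> first | (left; omega) | (right; tauto)
  refine ⟨⟨(val_sw hT hp hq h).1, (val_sw hT hp hq h).2, ?_⟩, key⟩
  intro i k j hik hkj hj
  have b := hT.2.2 i k j hik hkj hj
  have m1 := cell_mem (n := n) hik (by omega)
  have m2 := cell_mem (n := n) hkj (by omega)
  have m3 := cell_mem (n := n) (i := i) (j := j) (by omega) (by omega)
  have c1 : T' (cell n i k) < T' (cell n i j) ↔ T (cell n i k) < T (cell n i j) := by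
    rcases key _ m1 _ m3 with h | ⟨h, h'⟩ | ⟨h, h'⟩
    · exact h
    · subst h; subst h'; exact absurd rfl h1
    · subst h; subst h'; exact absurd rfl h1
  have c1' : T' (cell n i j) < T' (cell n i k) ↔ T (cell n i j) < T (cell n i k) := by
    rcases key _ m3 _ m1 with h | ⟨h, h'⟩ | ⟨h, h'⟩
    · exact h
    · subst h; subst h'; exact absurd rfl h1
    · subst h; subst h'; exact absurd rfl h1
  have c2 : T' (cell n k j) < T' (cell n i j) ↔ T (cell n k j) < T (cell n i j) := by
    rcases key _ m2 _ m3 with h | ⟨h, h'⟩ | ⟨h, h'⟩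
    · exact h
    · subst h; subst h'; exact absurd rfl h2
    · subst h; subst h'; exact absurd rfl h2
  have c2' : T' (cell n i j) < T' (cell n k j) ↔ T (cell n i j) < T (cell n k j) := by
    rcases key _ m3 _ m2 with h | ⟨h, h'⟩ | ⟨h, h'⟩
    · exact h
    · subst h; subst h'; exact absurd rfl h2
    · subst h; subst h'; exact absurd rfl h2
  rw [c1, c1', c2, c2']
  exact b

/-- Yang–Baxter moves preserve validity and all but one of the relevant relative orders. -/
lemma yb_step {n : ℕ} {T T' : ℕ × ℕ → ℕ} (hT : Val n T) {a m l : ℕ} (ham : a < m)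
    (hml : m < l) (hl : l < n)
    (hc : (T (cell n a l) = T (cell n a m) + 1 ∧ T (cell n m l) = T (cell n a m) + 2) ∨
      (T (cell n a l) = T (cell n m l) + 1 ∧ T (cell n a m) = T (cell n m l) + 2))
    (h : ∀ z ∈ St n, T' z = sw (T (cell n a m)) (T (cell n m l)) (T z)) :
    Val n T' ∧ ∀ x ∈ St n, ∀ y ∈ St n, x.1 ≠ y.1 → x.2 ≠ y.2 → (T' x < T' y ↔ T x < T y) ∨
      (x = cell n a m ∧ y = cell n m l) ∨ (x = cell n m l ∧ y = cell n a m) := by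
  have q1 := cell_mem (n := n) ham (by omega)
  have q2 := cell_mem (n := n) hml (by omega)
  have q3 := cell_mem (n := n) (i := a) (j := l) (by omega) (by omega)
  constructor
  · refine ⟨(val_sw hT q1 q2 h).1, (val_sw hT q1 q2 h).2, ?_⟩
    intro i k j hik hkj hj
    have b := hT.2.2 i k j hik hkj hj
    have m1 := cell_mem (n := n) hik (by omega)
    have m2 := cell_mem (n := n) hkj (by omega)
    have m3 := cell_mem (n := n) (i := i) (j := j) (by omega) (by omega)
    by_cases hs : i = a ∧ k = m ∧ j = l
    · obtain ⟨rfl, rfl, rfl⟩ := hs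
      rw [h _ m1, h _ m2, h _ m3]
      unfold sw
      split_ifs <;> omega
    · have hin := fun {i j i' j'} => @ne_of_ne n T hT.1 i j i' j'
      have e1 := hin hik (by omega) ham (by omega)
      have e2 := hin hik (by omega) hml (by omega)
      have e3 := hin hik (by omega) (ham.trans hml) (by omega)
      have f1 := hin hkj (by omega) ham (by omega)
      have f2 := hin hkj (by omega) hml (by omega)
      have f3 := hin hkj (by omega) (ham.trans hml) (by omega)
      have g1 := hin (hik.trans hkj) (by omega) ham (by omega)
      have g2 := hin (hik.trans hkj) (by omega) hml (by omega)
      have g3 := hin (hik.trans hkj) (by omega) (ham.trans hml) (by omega)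
      rw [h _ m1, h _ m2, h _ m3]
      unfold sw
      generalize T (cell n a m) = x1 at *
      generalize T (cell n m l) = x2 at *
      generalize T (cell n a l) = x3 at *
      generalize T (cell n i k) = y1 at *
      generalize T (cell n k j) = y2 at *
      generalize T (cell n i j) = y3 at *
      clear h m1 m2 m3 q1 q2 q3 hin
      split_ifs <;> omega
  · intro x hx y hy hxy1 hxy2
    have e1 : T x = T (cell n a m) → x = cell n a m := fun e => hT.1 hx q1 e
    have e2 : T x = T (cell n m l) → x = cell n m l := fun e => hT.1 hx q2 e
    have e3 : T x = T (cell n a l) → x = cell n a l := fun e => hT.1 hx q3 e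
    have e4 : T y = T (cell n a m) → y = cell n a m := fun e => hT.1 hy q1 e
    have e5 : T y = T (cell n m l) → y = cell n m l := fun e => hT.1 hy q2 e
    have e6 : T y = T (cell n a l) → y = cell n a l := fun e => hT.1 hy q3 e
    rw [h x hx, h y hy]
    have cx : x = cell n a m ∨ x = cell n m l ∨ x = cell n a l ∨ (T x ≠ T (cell n a m) ∧
        T x ≠ T (cell n m l) ∧ T x ≠ T (cell n a l)) := by
      by_cases u1 : T x = T (cell n a m)
      · exact Or.inl (e1 u1)
      by_cases u2 : T x = T (cell n m l)
      · exact Or.inr (Or.inl (e2 u2))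
      by_cases u3 : T x = T (cell n a l)
      · exact Or.inr (Or.inr (Or.inl (e3 u3)))
      exact Or.inr (Or.inr (Or.inr ⟨u1, u2, u3⟩))
    have cy : y = cell n a m ∨ y = cell n m l ∨ y = cell n a l ∨ (T y ≠ T (cell n a m) ∧
        T y ≠ T (cell n m l) ∧ T y ≠ T (cell n a l)) := by
      by_cases u1 : T y = T (cell n a m)
      · exact Or.inl (e4 u1)
      by_cases u2 : T y = T (cell n m l)
      · exact Or.inr (Or.inl (e5 u2))
      by_cases u3 : T y = T (cell n a l)
      · exact Or.inr (Or.inr (Or.inl (e6 u3)))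
      exact Or.inr (Or.inr (Or.inr ⟨u1, u2, u3⟩))
    clear e1 e2 e3 e4 e5 e6 h hx hy
    rcases cx with rfl | rfl | rfl | cx <;> rcases cy with rfl | rfl | rfl | cy <;>
    first
    | exact absurd rfl hxy1
    | exact absurd rfl hxy2
    | exact Or.inr (Or.inl ⟨rfl, rfl⟩)
    | exact Or.inr (Or.inr ⟨rfl, rfl⟩)
    | (left; unfold sw; split_ifs <;> omega)

/-- Moves, only prescribed on the diagram. -/
def WStep (n : ℕ) (T T' : ℕ × ℕ → ℕ) : Prop :=
  (∃ x ∈ St n, ∃ y ∈ St n, T y = T x + 1 ∧ x.1 ≠ y.1 ∧ x.2 ≠ y.2 ∧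
    ∀ z ∈ St n, T' z = sw (T x) (T y) (T z)) ∨
  (∃ a m l, a < m ∧ m < l ∧ l < n ∧
    ((T (cell n a l) = T (cell n a m) + 1 ∧ T (cell n m l) = T (cell n a m) + 2) ∨
      (T (cell n a l) = T (cell n m l) + 1 ∧ T (cell n a m) = T (cell n m l) + 2)) ∧
    ∀ z ∈ St n, T' z = sw (T (cell n a m)) (T (cell n m l)) (T z))

lemma wstep_of_cmove {n : ℕ} {T T' : ℕ × ℕ → ℕ} (hT : Val n T) (h : CMoveT (St n) T T') :
    WStep n T T' := by
  rcases h with ⟨i, x, hx, y, hy, h1, h2, h3, h4, h5⟩ | ⟨i, hi, x, hx, y, hy, z, hz, h1, h2, h3, h4, h5, h6, h7⟩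
  · left
    refine ⟨x, hx, y, hy, by omega, h3, h4, ?_⟩
    intro z _
    rw [h5 z, h2, h1]; rfl
  · right
    obtain ⟨a, l, hal, hl, rfl⟩ := exists_cell hx
    obtain ⟨k, l', hkl, hl', rfl⟩ := exists_cell hy
    obtain ⟨a', k', hak', hk', rfl⟩ := exists_cell hz
    simp only [cell] at h3 h4 h5 h6
    obtain rfl : l' = l := by omega
    obtain rfl : a' = a := by omega
    have hk'l : k' < l' := by omega
    have hkk : k = k' := by
      have b1 := hT.2.2 _ _ _ h4 hkl hl
      have b2 := hT.2.2 _ _ _ hak' hk'l hl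
      have hin := fun {i j i' j'} => @ne_of_ne n T hT.1 i j i' j'
      rcases lt_trichotomy k k' with h | h | h
      · exfalso
        have b3 := hT.2.2 _ _ _ h4 h hk'
        have b4 := hT.2.2 _ _ _ h hk'l hl
        have := hin h hk' hal hl
        omega
      · exact h
      · exfalso
        have b3 := hT.2.2 _ _ _ hak' h (by omega)
        have b4 := hT.2.2 _ _ _ h hkl hl
        have := hin h (by omega) hal hl
        omega
    subst hkk
    refine ⟨a', k, l', h4, hkl, hl, by omega, ?_⟩
    intro u _
    rw [h7 u]
    unfold sw
    split_ifs <;> omega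

lemma cmove_of_wstep {n : ℕ} {T T' g : ℕ × ℕ → ℕ} (hT : Val n T) (h : WStep n T T')
    (hg : ∀ x ∈ St n, g x = T x) : ∃ g', CMoveT (St n) g g' ∧ ∀ x ∈ St n, g' x = T' x := by
  rcases h with ⟨x, hx, y, hy, h1, h2, h3, h4⟩ | ⟨a, m, l, ham, hml, hl, hc, h4⟩
  · refine ⟨fun z => sw (T x) (T y) (g z), Or.inl ⟨T x, x, hx, y, hy, hg x hx, ?_, h2, h3, ?_⟩, ?_⟩
    · rw [hg y hy, h1]
    · intro z; rw [h1]; rfl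
    · intro z hz; simp only [h4 z hz, hg z hz]
  · have q1 := cell_mem (n := n) ham (by omega)
    have q2 := cell_mem (n := n) hml (by omega)
    have q3 := cell_mem (n := n) (i := a) (j := l) (by omega) (by omega)
    have pos : ∀ z ∈ St n, 1 ≤ T z := fun z hz => by
      have : T z ∈ Finset.Icc 1 (St n).card := by
        rw [← hT.2.1]; exact Finset.mem_image_of_mem _ hz
      exact (Finset.mem_Icc.1 this).1
    have := pos _ q1
    have := pos _ q2
    refine ⟨fun z => sw (T (cell n a m)) (T (cell n m l)) (g z), Or.inr ⟨T (cell n a l), by omega,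
      _, q3, _, q2, _, q1, hg _ q3, ?_, rfl, ham, rfl, ?_, ?_⟩, ?_⟩
    · rw [hg _ q1, hg _ q2]; omega
    · simp only [cell]; omega
    · intro u
      simp only [sw]
      split_ifs <;> omega
    · intro z hz; simp only [h4 z hz, hg z hz]

lemma wstep_val {n : ℕ} {T T' : ℕ × ℕ → ℕ} (hT : Val n T) (h : WStep n T T') : Val n T' := by
  rcases h with ⟨x, hx, y, hy, h1, h2, h3, h4⟩ | ⟨a, m, l, ham, hml, hl, hc, h4⟩
  · exact (comm_step hT hx hy h1 h2 h3 h4).1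
  · exact (yb_step hT ham hml hl hc h4).1

lemma wstep_symm {n : ℕ} {T T' : ℕ × ℕ → ℕ} (h : WStep n T T') : WStep n T' T := by
  rcases h with ⟨x, hx, y, hy, h1, h2, h3, h4⟩ | ⟨a, m, l, ham, hml, hl, hc, h4⟩
  · have e1 : T' x = T y := by rw [h4 x hx]; simp [sw]
    have e2 : T' y = T x := by rw [h4 y hy]; simp [sw, h1]
    refine Or.inl ⟨y, hy, x, hx, by omega, h2.symm, h3.symm, ?_⟩
    intro z hz
    rw [e1, e2, h4 z hz]
    unfold sw
    split_ifs <;> omega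
  · have e1 : T' (cell n a m) = T (cell n m l) := by
      rw [h4 _ (cell_mem ham (by omega))]; simp [sw]
    have e2 : T' (cell n m l) = T (cell n a m) := by
      rw [h4 _ (cell_mem hml (by omega))]; unfold sw; split_ifs <;> omega
    have e3 : T' (cell n a l) = T (cell n a l) := by
      rw [h4 _ (cell_mem (ham.trans hml) (by omega))]; unfold sw; split_ifs <;> omega
    refine Or.inr ⟨a, m, l, ham, hml, hl, by omega, ?_⟩
    intro z hz
    rw [e1, e2, h4 z hz]
    unfold sw
    split_ifs <;> omega

lemma invS_le {n : ℕ} {T T' : ℕ × ℕ → ℕ} (hT : Val n T) (h : WStep n T T') :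
    (invS n T').card ≤ (invS n T).card + 1 := by
  have key : ∃ p q : ℕ × ℕ, p.1 < q.1 ∧ ∀ x ∈ St n, ∀ y ∈ St n, x.1 ≠ y.1 → x.2 ≠ y.2 →
      (T' x < T' y ↔ T x < T y) ∨ (x = p ∧ y = q) ∨ (x = q ∧ y = p) := by
    rcases h with ⟨x, hx, y, hy, h1, h2, h3, h4⟩ | ⟨a, m, l, ham, hml, hl, hc, h4⟩
    · have := (comm_step hT hx hy h1 h2 h3 h4).2
      rcases lt_or_gt_of_ne h2 with h | h
      · exact ⟨x, y, h, fun u hu v hv _ _ => this u hu v hv⟩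
      · refine ⟨y, x, h, fun u hu v hv _ _ => ?_⟩
        have := this u hu v hv
        tauto
    · exact ⟨_, _, ham, (yb_step hT ham hml hl hc h4).2⟩
  obtain ⟨p, q, hpq, key⟩ := key
  calc (invS n T').card ≤ (insert (p, q) (invS n T)).card := by
        apply Finset.card_le_card
        rintro ⟨x, y⟩ hP
        simp only [invS, Finset.mem_insert, Finset.mem_filter, Finset.mem_product] at hP ⊢
        obtain ⟨⟨hx, hy⟩, h1, h2, h3⟩ := hP
        rcases key y hy x hx h1.ne' h2.symm with h | ⟨rfl, rfl⟩ | ⟨rfl, rfl⟩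
        · exact Or.inr ⟨⟨hx, hy⟩, h1, h2, h.1 h3⟩
        · omega
        · exact Or.inl rfl
    _ ≤ _ := Finset.card_insert_le _ _

lemma invS_lt {n : ℕ} {T T' : ℕ × ℕ → ℕ} {p q : ℕ × ℕ} (hp : p ∈ St n) (hq : q ∈ St n)
    (h1 : p.1 < q.1) (h2 : p.2 ≠ q.2) (h3 : T q < T p) (h4 : T' p < T' q)
    (key : ∀ x ∈ St n, ∀ y ∈ St n, x.1 ≠ y.1 → x.2 ≠ y.2 →
      (T' x < T' y ↔ T x < T y) ∨ (x = p ∧ y = q) ∨ (x = q ∧ y = p)) :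
    (invS n T').card < (invS n T).card := by
  apply Finset.card_lt_card
  rw [Finset.ssubset_iff_of_subset]
  · refine ⟨(p, q), ?_, ?_⟩
    · simp only [invS, Finset.mem_filter, Finset.mem_product]
      exact ⟨⟨hp, hq⟩, h1, h2, h3⟩
    · simp only [invS, Finset.mem_filter, Finset.mem_product]
      omega
  · rintro ⟨x, y⟩ hP
    simp only [invS, Finset.mem_filter, Finset.mem_product] at hP ⊢
    obtain ⟨⟨hx, hy⟩, g1, g2, g3⟩ := hP
    rcases key y hy x hx g1.ne' g2.symm with h | ⟨rfl, rfl⟩ | ⟨rfl, rfl⟩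
    · exact ⟨⟨hx, hy⟩, g1, g2, h.1 g3⟩
    · omega
    · omega

lemma val_range {n : ℕ} {T : ℕ × ℕ → ℕ} (hT : Val n T) {z : ℕ × ℕ} (hz : z ∈ St n) :
    1 ≤ T z ∧ T z ≤ (St n).card := by
  have : T z ∈ Finset.Icc 1 (St n).card := by
    rw [← hT.2.1]; exact Finset.mem_image_of_mem _ hz
  exact Finset.mem_Icc.1 this

lemma val_surj {n : ℕ} {T : ℕ × ℕ → ℕ} (hT : Val n T) {v : ℕ} (h1 : 1 ≤ v)
    (h2 : v ≤ (St n).card) : ∃ i j, i < j ∧ j < n ∧ T (cell n i j) = v := by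
  have : v ∈ (St n).image T := by rw [hT.2.1]; exact Finset.mem_Icc.2 ⟨h1, h2⟩
  obtain ⟨z, hz, rfl⟩ := Finset.mem_image.1 this
  obtain ⟨i, j, h3, h4, rfl⟩ := exists_cell hz
  exact ⟨i, j, h3, h4, rfl⟩

/-- The lexicographic order of pairs, on cells. -/
def Lx (x y : ℕ × ℕ) : Prop := x.1 < y.1 ∨ (x.1 = y.1 ∧ y.2 < x.2)

/-- The greedy step. -/
lemma greedy {n : ℕ} {T : ℕ × ℕ → ℕ} (hT : Val n T) :
    (∃ T', WStep n T T' ∧ (invS n T').card < (invS n T).card) ∨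
    (∀ x ∈ St n, ∀ y ∈ St n, Lx x y → T x < T y) := by
  classical
  by_cases hbad : ∃ a, ∃ j, a < j ∧ j < n ∧ ∃ k l, a < k ∧ k < l ∧ l < n ∧
      T (cell n k l) < T (cell n a j)
  · left
    obtain ⟨j0, haj0, hj0, hq⟩ := Nat.find_spec hbad
    have hmin := fun {b} => @Nat.find_min _ _ hbad b
    generalize Nat.find hbad = a at *
    -- earlier rows come first
    have hearly : ∀ b j k l, b < a → b < j → j < n → b < k → k < l → l < n →
        T (cell n b j) ≤ T (cell n k l) := by
      intro b j k l hb h1 h2 h3 h4 h5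
      by_contra hlt
      exact hmin hb ⟨j, h1, h2, k, l, h3, h4, h5, by omega⟩
    let S := (St n).filter fun q => a < q.1 ∧ ∃ j, a < j ∧ j < n ∧ T q < T (cell n a j)
    have hS : S.Nonempty := by
      obtain ⟨k, l, h1, h2, h3, h4⟩ := hq
      exact ⟨cell n k l, Finset.mem_filter.2 ⟨cell_mem h2 h3, h1, j0, haj0, hj0, h4⟩⟩
    obtain ⟨q, hqS, hqmax⟩ := Finset.exists_max_image S T hS
    obtain ⟨hqD, hqa, j1, haj1, hj1, hqj1⟩ := Finset.mem_filter.1 hqS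
    obtain ⟨k, l, hkl, hl, rfl⟩ := exists_cell hqD
    have hak : a < k := hqa
    have hdich : ∀ k' l' j, a < k' → k' < l' → l' < n → a < j → j < n →
        T (cell n k' l') ≤ T (cell n k l) ∨ T (cell n a j) < T (cell n k' l') := by
      intro k' l' j h1 h2 h3 h4 h5
      by_contra hc
      rw [not_or, not_le, not_lt] at hc
      have hne : T (cell n k' l') ≠ T (cell n a j) := fun e => by
        have := ne_of_ne hT.1 h2 h3 h4 h5 e
        omega
      have := hqmax (cell n k' l') (Finset.mem_filter.2 ⟨cell_mem h2 h3, h1, j, h4, h5, by omega⟩)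
      omega
    clear hqmax hqS hS S hq hmin hbad
    -- the next elements have row a
    have hrow : ∀ i j j2, i < j → j < n → a < j2 → j2 < n → T (cell n k l) < T (cell n i j) →
        T (cell n i j) ≤ T (cell n a j2) → i = a := by
      intro i j j2 h1 h2 h3 h4 h5 h6
      rcases lt_trichotomy i a with h | h | h
      · have := hearly i j k l h h1 h2 (by omega) hkl hl
        omega
      · exact h
      · have := hdich i j j2 h h1 h2 h3 h4
        omega
    have hr1 := val_range hT hqD
    have hr2 := val_range hT (cell_mem haj1 hj1)
    obtain ⟨i, j, hij, hj, hTj⟩ := val_surj hT (v := T (cell n k l) + 1) (by omega) (by omega)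
    obtain rfl := hrow i j j1 hij hj haj1 hj1 (by omega) (by omega)
    by_cases hjl : j = l
    · subst hjl
      have b := hT.2.2 i k j hak hkl hl
      have hr3 := val_range hT (cell_mem hak (hkl.trans hl))
      obtain ⟨i', m, him, hm, hTm⟩ := val_surj hT (v := T (cell n k j) + 2) (by omega) (by omega)
      obtain rfl := hrow i' m k him hm hak (by omega) (by omega) (by omega)
      have hmk : m = k := by
        by_contra hmk
        have nmk := fun e => hmk (ne_of_ne hT.1 him hm hak (hkl.trans hl) e).2
        have hmj : m ≠ j := by rintro rfl; omega
        rcases lt_or_gt_of_ne hmk with h | h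
        · have b1 := hT.2.2 i' m k him h (by omega)
          have b2 := hT.2.2 i' m j him (by omega) (by omega)
          have b3 := hT.2.2 m k j h hkl hl
          have d1 := hdich m k k him h (by omega) hak (by omega)
          have d2 := hdich m j k him (by omega) hl hak (by omega)
          omega
        · rcases lt_or_gt_of_ne hmj with h' | h'
          · have b1 := hT.2.2 i' k m hak h (by omega)
            have b2 := hT.2.2 i' m j him (by omega) (by omega)
            have b3 := hT.2.2 k m j h h' hl
            have d1 := hdich k m k hak h (by omega) hak (by omega)
            have d2 := hdich m j k him (by omega) hl hak (by omega)
            omega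
          · have b1 := hT.2.2 i' k m hak h (by omega)
            have b2 := hT.2.2 i' j m hij (by omega) (by omega)
            have b3 := hT.2.2 k j m hkl h' hm
            have d1 := hdich k m k hak h (by omega) hak (by omega)
            have d2 := hdich j m k hij (by omega) hm hak (by omega)
            omega
      subst hmk
      refine ⟨fun z => sw (T (cell n i' m)) (T (cell n m j)) (T z),
        Or.inr ⟨i', m, j, hak, hkl, hl, Or.inr ⟨hTj, hTm⟩, fun z _ => rfl⟩, ?_⟩
      apply invS_lt (p := cell n i' m) (q := cell n m j) (cell_mem him hm) hqD hak
      · simp only [cell]; omega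
      · omega
      · simp only [sw]; split_ifs <;> omega
      · exact (yb_step hT hak hkl hl (Or.inr ⟨hTj, hTm⟩) (fun z _ => rfl)).2
    · have hc : (cell n k l).2 ≠ (cell n i j).2 := by simp only [cell]; omega
      refine ⟨fun z => sw (T (cell n k l)) (T (cell n i j)) (T z),
        Or.inl ⟨cell n k l, hqD, cell n i j, cell_mem hij hj, hTj, hak.ne', hc, fun z _ => rfl⟩, ?_⟩
      apply invS_lt (p := cell n i j) (q := cell n k l) (cell_mem hij hj) hqD hak hc.symm
      · omega
      · simp only [sw]; split_ifs <;> omega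
      · intro x hx y hy _ _
        have := (comm_step hT hqD (cell_mem hij hj) hTj hak.ne' hc (fun z _ => rfl)).2 x hx y hy
        tauto
  · right
    push Not at hbad
    have hlt : ∀ a j k l, a < j → j < n → a < k → k < l → l < n →
        T (cell n a j) < T (cell n k l) := by
      intro a j k l h1 h2 h3 h4 h5
      have := hbad a j h1 h2 k l h3 h4 h5
      have hne : T (cell n k l) ≠ T (cell n a j) := fun e => by
        have := ne_of_ne hT.1 h4 h5 h1 h2 e
        omega
      omega
    intro x hx y hy hxy
    obtain ⟨a, j, haj, hj, rfl⟩ := exists_cell hx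
    obtain ⟨k, l, hkl, hl, rfl⟩ := exists_cell hy
    rcases hxy with h | ⟨h, h'⟩
    · exact hlt _ _ _ _ haj hj h hkl hl
    · simp only [cell] at h h'
      subst h
      have b := hT.2.2 a j l haj (by omega) hl
      have := hlt a j j l haj hj haj (by omega) hl
      omega

open Classical in
/-- The lexicographic tableau. -/
noncomputable def R0 (n : ℕ) (x : ℕ × ℕ) : ℕ := ((St n).filter fun y => y = x ∨ Lx y x).card

lemma R0_lt {n : ℕ} {x y : ℕ × ℕ} (hy : y ∈ St n) (h : Lx x y) : R0 n x < R0 n y := by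
  classical
  unfold R0
  apply Finset.card_lt_card
  rw [Finset.ssubset_iff_of_subset]
  · refine ⟨y, ?_, ?_⟩
    · simp [hy]
    · simp only [Finset.mem_filter, not_and, not_or]
      intro _
      unfold Lx at *
      refine ⟨?_, by omega⟩
      rintro rfl
      omega
  · intro z hz
    simp only [Finset.mem_filter] at hz ⊢
    refine ⟨hz.1, Or.inr ?_⟩
    rcases hz.2 with rfl | h'
    · exact h
    · unfold Lx at *; omega

lemma Lx_total {x y : ℕ × ℕ} (h : x ≠ y) : Lx x y ∨ Lx y x := by
  unfold Lx
  by_contra hc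
  apply h
  ext <;> omega

lemma R0_val (n : ℕ) : Val n (R0 n) := by
  classical
  have hinj : Set.InjOn (R0 n) ↑(St n) := by
    intro x hx y hy e
    by_contra hne
    rcases Lx_total hne with h | h
    · have := R0_lt (n := n) hy h; omega
    · have := R0_lt (n := n) hx h; omega
  refine ⟨hinj, ?_, ?_⟩
  · apply Finset.eq_of_subset_of_card_le
    · intro w hw
      rw [Finset.mem_image] at hw
      obtain ⟨z, hz, rfl⟩ := hw
      rw [Finset.mem_Icc]
      constructor
      · apply Finset.card_pos.2
        exact ⟨z, Finset.mem_filter.2 ⟨hz, Or.inl rfl⟩⟩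
      · exact Finset.card_le_card (Finset.filter_subset _ _)
    · rw [Finset.card_image_of_injOn hinj]; simp
  · intro i k j hik hkj hj
    left
    constructor
    · apply R0_lt (cell_mem (by omega) hj)
      right; simp only [cell, true_and]; omega
    · apply R0_lt (cell_mem hkj hj)
      left; simp only [cell]; omega

lemma eq_R0 {n : ℕ} {T : ℕ × ℕ → ℕ} (hT : Val n T)
    (h : ∀ x ∈ St n, ∀ y ∈ St n, Lx x y → T x < T y) : ∀ x ∈ St n, T x = R0 n x := by
  classical
  intro x hx
  have e : ((St n).filter fun y => y = x ∨ Lx y x).image T = Finset.Icc 1 (T x) := by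
    ext v
    simp only [Finset.mem_image, Finset.mem_filter, Finset.mem_Icc]
    constructor
    · rintro ⟨y, ⟨hy, hyx⟩, rfl⟩
      refine ⟨(val_range hT hy).1, ?_⟩
      rcases hyx with rfl | h'
      · exact le_rfl
      · exact (h y hy x hx h').le
    · rintro ⟨h1, h2⟩
      obtain ⟨i, j, hij, hj, e⟩ := val_surj hT h1 (h2.trans (val_range hT hx).2)
      refine ⟨_, ⟨cell_mem hij hj, ?_⟩, e⟩
      by_cases hc : cell n i j = x
      · exact Or.inl hc
      · right
        rcases Lx_total hc with h' | h'
        · exact h'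
        · have := h x hx _ (cell_mem hij hj) h'
          omega
  have e2 := congrArg Finset.card e
  rw [Finset.card_image_of_injOn (hT.1.mono (by intro z hz; exact (Finset.mem_filter.1 hz).1))] at e2
  rw [Nat.card_Icc, Nat.add_sub_cancel] at e2
  unfold R0
  convert e2.symm using 1

/-- Paths of moves. -/
def WPath (n : ℕ) : ℕ → (ℕ × ℕ → ℕ) → (ℕ × ℕ → ℕ) → Prop
  | 0, T, S => ∀ x ∈ St n, T x = S x
  | m + 1, T, S => ∃ T1, WStep n T T1 ∧ WPath n m T1 S

lemma wstep_congr {n : ℕ} {T S T' : ℕ × ℕ → ℕ} (h : ∀ x ∈ St n, T x = S x) (hs : WStep n T T') :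
    WStep n S T' := by
  rcases hs with ⟨x, hx, y, hy, h1, h2, h3, h4⟩ | ⟨a, m, l, ham, hml, hl, hc, h4⟩
  · refine Or.inl ⟨x, hx, y, hy, ?_, h2, h3, ?_⟩
    · rw [← h x hx, ← h y hy, h1]
    · intro z hz; rw [← h x hx, ← h y hy, ← h z hz, h4 z hz]
  · have q1 := h _ (cell_mem (n := n) ham (by omega))
    have q2 := h _ (cell_mem (n := n) hml (by omega))
    have q3 := h _ (cell_mem (n := n) (i := a) (j := l) (by omega) (by omega))
    refine Or.inr ⟨a, m, l, ham, hml, hl, by omega, ?_⟩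
    intro z hz; rw [← q1, ← q2, ← h z hz, h4 z hz]

lemma wpath_congr {n m : ℕ} {T S U : ℕ × ℕ → ℕ} (h : ∀ x ∈ St n, T x = S x)
    (hp : WPath n m T U) : WPath n m S U := by
  cases m with
  | zero => exact fun x hx => (h x hx).symm.trans (hp x hx)
  | succ m =>
    obtain ⟨T1, h1, h2⟩ := hp
    exact ⟨T1, wstep_congr h h1, h2⟩

lemma wpath_trans {n : ℕ} {a b : ℕ} {T S U : ℕ × ℕ → ℕ} (h : WPath n a T S)
    (h' : WPath n b S U) : WPath n (a + b) T U := by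
  induction a generalizing T with
  | zero => rw [Nat.zero_add]; exact wpath_congr (fun x hx => (h x hx).symm) h'
  | succ a ih =>
    obtain ⟨T1, h1, h2⟩ := h
    rw [show a + 1 + b = (a + b) + 1 by omega]
    exact ⟨T1, h1, ih h2⟩

lemma wpath_symm {n : ℕ} {a : ℕ} {T S : ℕ × ℕ → ℕ} (h : WPath n a T S) : WPath n a S T := by
  induction a generalizing T with
  | zero => exact fun x hx => (h x hx).symm
  | succ a ih =>
    obtain ⟨T1, h1, h2⟩ := h
    exact wpath_trans (ih h2) ⟨T, wstep_symm h1, fun _ _ => rfl⟩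

lemma wpath_R0 {n : ℕ} : ∀ d (T : ℕ × ℕ → ℕ), Val n T → (invS n T).card = d →
    ∃ m ≤ d, WPath n m T (R0 n) := by
  intro d
  induction d using Nat.strong_induction_on with
  | _ d ih =>
  intro T hT hd
  rcases greedy hT with ⟨T', h1, h2⟩ | h
  · obtain ⟨m, hm, hp⟩ := ih _ (hd ▸ h2) T' (wstep_val hT h1) rfl
    exact ⟨m + 1, by omega, T', h1, hp⟩
  · exact ⟨0, Nat.zero_le _, eq_R0 hT h⟩

lemma wpath_two {n : ℕ} {R S : ℕ × ℕ → ℕ} (hR : Val n R) (hS : Val n S) :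
    ∃ m ≤ (invS n R).card + (invS n S).card, WPath n m R S := by
  obtain ⟨a, ha, pa⟩ := wpath_R0 _ R hR rfl
  obtain ⟨b, hb, pb⟩ := wpath_R0 _ S hS rfl
  exact ⟨a + b, by omega, wpath_trans pa (wpath_symm pb)⟩

/-- The reversed tableau. -/
def op (n : ℕ) (T : ℕ × ℕ → ℕ) (x : ℕ × ℕ) : ℕ := (St n).card + 1 - T x

lemma op_val {n : ℕ} {T : ℕ × ℕ → ℕ} (hT : Val n T) : Val n (op n T) := by
  have hinj : Set.InjOn (op n T) ↑(St n) := by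
    intro x hx y hy e
    apply hT.1 hx hy
    have := val_range hT hx
    have := val_range hT hy
    unfold op at e
    omega
  refine ⟨hinj, ?_, ?_⟩
  · apply Finset.eq_of_subset_of_card_le
    · intro w hw
      rw [Finset.mem_image] at hw
      obtain ⟨z, hz, rfl⟩ := hw
      rw [Finset.mem_Icc]
      have := val_range hT hz
      unfold op
      omega
    · rw [Finset.card_image_of_injOn hinj]; simp
  · intro i k j hik hkj hj
    have b := hT.2.2 i k j hik hkj hj
    have r1 := val_range hT (cell_mem (n := n) hik (by omega))
    have r2 := val_range hT (cell_mem (n := n) hkj (by omega))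
    have r3 := val_range hT (cell_mem (n := n) (i := i) (j := j) (by omega) (by omega))
    unfold op
    omega

lemma op_step {n : ℕ} {T T' : ℕ × ℕ → ℕ} (hT : Val n T) (h : WStep n T T') :
    WStep n (op n T) (op n T') := by
  rcases h with ⟨x, hx, y, hy, h1, h2, h3, h4⟩ | ⟨a, m, l, ham, hml, hl, hc, h4⟩
  · have r1 := val_range hT hx
    have r2 := val_range hT hy
    refine Or.inl ⟨y, hy, x, hx, by unfold op; omega, h2.symm, h3.symm, ?_⟩
    intro z hz
    have r3 := val_range hT hz
    unfold op
    rw [h4 z hz]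
    unfold sw
    split_ifs <;> omega
  · have r1 := val_range hT (cell_mem (n := n) ham (by omega))
    have r2 := val_range hT (cell_mem (n := n) hml (by omega))
    have r3 := val_range hT (cell_mem (n := n) (i := a) (j := l) (by omega) (by omega))
    refine Or.inr ⟨a, m, l, ham, hml, hl, by unfold op; omega, ?_⟩
    intro z hz
    have r4 := val_range hT hz
    unfold op
    rw [h4 z hz]
    unfold sw
    split_ifs <;> omega

lemma op_path {n : ℕ} {a : ℕ} {T S : ℕ × ℕ → ℕ} (hT : Val n T) (h : WPath n a T S) :
    WPath n a (op n T) (op n S) := by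
  induction a generalizing T with
  | zero => exact fun x hx => by unfold op; rw [h x hx]
  | succ a ih =>
    obtain ⟨T1, h1, h2⟩ := h
    exact ⟨_, op_step hT h1, ih (wstep_val hT h1) h2⟩

lemma op_op {n : ℕ} {T : ℕ × ℕ → ℕ} (hT : Val n T) : ∀ x ∈ St n, op n (op n T) x = T x := by
  intro x hx
  have := val_range hT hx
  unfold op
  omega

/-- All relevant pairs. -/
def flats (n : ℕ) : Finset ((ℕ × ℕ) × (ℕ × ℕ)) :=
  (St n ×ˢ St n).filter fun P => P.1.1 < P.2.1 ∧ P.1.2 ≠ P.2.2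

lemma inv_op {n : ℕ} {T : ℕ × ℕ → ℕ} (hT : Val n T) :
    (invS n T).card + (invS n (op n T)).card = (flats n).card := by
  have e1 : invS n T = (flats n).filter fun P => T P.2 < T P.1 := by
    unfold invS flats
    rw [Finset.filter_filter]
    apply Finset.filter_congr
    intros; tauto
  have e2 : invS n (op n T) = (flats n).filter fun P => ¬ T P.2 < T P.1 := by
    unfold invS flats
    rw [Finset.filter_filter]
    apply Finset.filter_congr
    rintro ⟨x, y⟩ h
    rw [Finset.mem_product] at h
    have r1 := val_range hT h.1
    have r2 := val_range hT h.2
    simp only at r1 r2 ⊢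
    rw [← and_assoc]
    apply and_congr_right
    intro h3
    have : T x ≠ T y := fun e => by
      have := hT.1 h.1 h.2 e
      simp only at this
      subst this
      omega
    unfold op
    omega
  rw [e1, e2]
  exact Finset.card_filter_add_card_filter_not _

lemma inv_R0 (n : ℕ) : (invS n (R0 n)).card = 0 := by
  rw [Finset.card_eq_zero]
  unfold invS
  rw [Finset.filter_eq_empty_iff]
  rintro ⟨x, y⟩ h ⟨h1, h2, h3⟩
  rw [Finset.mem_product] at h
  have := R0_lt (n := n) h.2 (Or.inl h1 : Lx x y)
  exact lt_asymm this h3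

lemma inv_congr {n : ℕ} {T S : ℕ × ℕ → ℕ} (h : ∀ x ∈ St n, T x = S x) : invS n T = invS n S := by
  unfold invS
  apply Finset.filter_congr
  rintro ⟨x, y⟩ hxy
  rw [Finset.mem_product] at hxy
  simp only
  rw [h x hxy.1, h y hxy.2]

lemma upper {n : ℕ} {R S : ℕ × ℕ → ℕ} (hR : Val n R) (hS : Val n S) :
    ∃ m ≤ (flats n).card, WPath n m R S := by
  have i1 := inv_op hR
  have i2 := inv_op hS
  by_cases h : (invS n R).card + (invS n S).card ≤ (flats n).card
  · obtain ⟨m, hm, hp⟩ := wpath_two hR hS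
    exact ⟨m, by omega, hp⟩
  · obtain ⟨m, hm, hp⟩ := wpath_two (op_val hR) (op_val hS)
    refine ⟨m, by omega, ?_⟩
    have h1 := op_path (op_val hR) hp
    have h2 : WPath n 0 (op n (op n S)) S := op_op hS
    exact wpath_congr (op_op hR) (wpath_trans h1 h2)

lemma real_path {n m : ℕ} {T S g : ℕ × ℕ → ℕ} (hT : Val n T) (h : WPath n m T S)
    (hg : ∀ x ∈ St n, g x = T x) : ∃ f : ℕ → (ℕ × ℕ → ℕ), f 0 = g ∧
      (∀ k < m, CMoveT (St n) (f k) (f (k + 1))) ∧ ∀ x ∈ St n, f m x = S x := by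
  induction m generalizing T g with
  | zero => exact ⟨fun _ => g, rfl, by omega, fun x hx => (hg x hx).trans (h x hx)⟩
  | succ m ih =>
    obtain ⟨T1, h1, h2⟩ := h
    obtain ⟨g', c, e⟩ := cmove_of_wstep hT h1 hg
    obtain ⟨f, f0, f1, f2⟩ := ih (wstep_val hT h1) h2 e
    refine ⟨fun k => Nat.casesOn k g f, rfl, ?_, f2⟩
    intro k hk
    cases k with
    | zero => simp only [f0]; exact c
    | succ k => exact f1 k (by omega)

lemma lower {n m : ℕ} {f : ℕ → (ℕ × ℕ → ℕ)} (h0 : f 0 = R0 n)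
    (h1 : ∀ k < m, CMoveT (St n) (f k) (f (k + 1))) :
    ∀ k ≤ m, Val n (f k) ∧ (invS n (f k)).card ≤ k := by
  intro k
  induction k with
  | zero => intro _; rw [h0]; exact ⟨R0_val n, (inv_R0 n).le⟩
  | succ k ih =>
    intro hk
    obtain ⟨hv, hi⟩ := ih (by omega)
    have hs := wstep_of_cmove hv (h1 k (by omega))
    refine ⟨wstep_val hv hs, ?_⟩
    have := invS_le hv hs
    omega

lemma flats_sum (n : ℕ) : (flats n).card =
    ∑ k ∈ Finset.range (n - 1), (n - 1 - k) * ∑ a ∈ Finset.range k, (n - 2 - a) := by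
  have hD : ∀ P : ℕ × ℕ → Prop, [DecidablePred P] → ((St n).filter P).card =
      ∑ i ∈ Finset.range (n - 1), ((Finset.range (n - 1 - i)).filter fun c => P (i, c)).card := by
    intro P _
    rw [← Finset.card_sigma]
    symm
    apply Finset.card_bij (fun s _ => (s.1, s.2))
    · rintro ⟨i, c⟩ h
      simp only [Finset.mem_sigma, Finset.mem_range, Finset.mem_filter, mem_St] at h ⊢
      exact ⟨by omega, h.2.2⟩
    · rintro ⟨i, c⟩ _ ⟨i', c'⟩ _ e
      simp only [Prod.mk.injEq] at e
      obtain ⟨rfl, rfl⟩ := e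
      rfl
    · rintro ⟨i, c⟩ h
      simp only [Finset.mem_filter, mem_St] at h
      refine ⟨⟨i, c⟩, ?_, rfl⟩
      simp only [Finset.mem_sigma, Finset.mem_range, Finset.mem_filter]
      exact ⟨by omega, by omega, h.2⟩
  have hin : ∀ q ∈ St n, ((St n).filter fun p => p.1 < q.1 ∧ p.2 ≠ q.2).card =
      ∑ a ∈ Finset.range q.1, (n - 2 - a) := by
    intro q hq
    rw [mem_St] at hq
    rw [hD]
    have hsub : Finset.range q.1 ⊆ Finset.range (n - 1) := by
      intro a; simp only [Finset.mem_range]; omega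
    rw [← Finset.sum_subset hsub]
    · apply Finset.sum_congr rfl
      intro a ha
      rw [Finset.mem_range] at ha
      have : ((Finset.range (n - 1 - a)).filter fun c => (a, c).1 < q.1 ∧ (a, c).2 ≠ q.2) =
          (Finset.range (n - 1 - a)).erase q.2 := by
        ext c
        simp only [Finset.mem_filter, Finset.mem_erase, Finset.mem_range]
        omega
      rw [this, Finset.card_erase_of_mem (by rw [Finset.mem_range]; omega), Finset.card_range]
      omega
    · intro a _ ha
      rw [Finset.mem_range] at ha
      rw [Finset.card_eq_zero, Finset.filter_eq_empty_iff]
      intro c _ h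
      exact ha h.1
  have e1 : (flats n).card = ∑ q ∈ St n, ∑ a ∈ Finset.range q.1, (n - 2 - a) := by
    rw [← Finset.sum_congr rfl hin]
    unfold flats
    rw [Finset.card_filter, Finset.sum_product_right]
    apply Finset.sum_congr rfl
    intro q _
    rw [Finset.card_filter]
  rw [e1]
  have e2 : ∑ q ∈ St n, ∑ a ∈ Finset.range q.1, (n - 2 - a) =
      ∑ i ∈ Finset.range (n - 1), ∑ c ∈ Finset.range (n - 1 - i),
        ∑ a ∈ Finset.range i, (n - 2 - a) := by
    symm
    rw [Finset.sum_sigma']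
    apply Finset.sum_bij (fun (s : Σ _ : ℕ, ℕ) _ => ((s.1, s.2) : ℕ × ℕ))
    · rintro ⟨i, c⟩ h
      simp only [Finset.mem_sigma, Finset.mem_range, mem_St] at h ⊢
      omega
    · rintro ⟨i, c⟩ _ ⟨i', c'⟩ _ e
      simp only [Prod.mk.injEq] at e
      obtain ⟨rfl, rfl⟩ := e
      rfl
    · rintro ⟨i, c⟩ h
      simp only [mem_St] at h
      refine ⟨⟨i, c⟩, ?_, rfl⟩
      simp only [Finset.mem_sigma, Finset.mem_range]
      omega
    · intro _ _; rfl
  rw [e2]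
  apply Finset.sum_congr rfl
  intro i _
  rw [Finset.sum_const, Finset.card_range, smul_eq_mul]

lemma inner_sum (n k : ℕ) (h : k + 1 ≤ n) :
    2 * ((∑ a ∈ Finset.range k, (n - 2 - a) : ℕ) : ℤ) = k * (2 * n - 3 - k) := by
  induction k with
  | zero => simp
  | succ k ih =>
    rw [Finset.sum_range_succ]
    push_cast
    rw [mul_add]
    have := ih (by omega)
    push_cast at this
    rw [this]
    have : ((n - 2 - k : ℕ) : ℤ) = n - 2 - k := by omega
    rw [this]; ring

lemma outer_sum (n K : ℕ) (h : K + 1 ≤ n) :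
    24 * ((∑ k ∈ Finset.range K, (n - 1 - k) * ∑ a ∈ Finset.range k, (n - 2 - a) : ℕ) : ℤ) =
      (K - 1) * K * (3 * K ^ 2 + (13 - 12 * n) * K + (12 * n ^ 2 - 24 * n + 10) ) := by
  induction K with
  | zero => simp
  | succ k ih =>
    rw [Finset.sum_range_succ, Nat.cast_add, mul_add, ih (by omega), Nat.cast_mul]
    have e : ((n - 1 - k : ℕ) : ℤ) = n - 1 - k := by omega
    have := inner_sum n k (by omega)
    rw [e]
    push_cast at this ⊢
    linear_combination 12 * ((n : ℤ) - 1 - k) * this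

lemma flats_card (n : ℕ) : (flats n).card = (n - 2) * (n - 1) * n * (3 * n - 5) / 24 := by
  rcases lt_or_ge n 2 with h | h
  · rw [flats_sum]
    interval_cases n <;> simp
  · symm
    apply Nat.div_eq_of_eq_mul_right (by norm_num)
    have := outer_sum n (n - 1) (by omega)
    rw [← flats_sum] at this
    zify [h, show 1 ≤ n by omega, show 5 ≤ 3 * n by omega]
    rw [this]
    push_cast [show 1 ≤ n by omega]
    ring

end CoxDiam

/-- The maximal distance in the Coxeter-move graph between two standard balanced tableaux
on the staircase diagram `D(w₀)` (for `w₀` the longest permutation of `S_n`, here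
`Fin.revPerm`) equals `(n-2)(n-1)n(3n-5)/24`: every pair is connected by at most that
many moves, and some pair requires that many. -/
theorem coxeter_graph_diameter (n : ℕ) :
    (∀ R S : ℕ × ℕ → ℕ,
      IsSBT (RotheD n (Fin.revPerm : Equiv.Perm (Fin n))) R →
      IsSBT (RotheD n (Fin.revPerm : Equiv.Perm (Fin n))) S →
      ∃ m ≤ (n - 2) * (n - 1) * n * (3 * n - 5) / 24, ∃ f : ℕ → (ℕ × ℕ → ℕ),
        f 0 = R ∧
        (∀ k < m, CMoveT (RotheD n (Fin.revPerm : Equiv.Perm (Fin n))) (f k) (f (k + 1))) ∧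
        (∀ x ∈ RotheD n (Fin.revPerm : Equiv.Perm (Fin n)), f m x = S x)) ∧
    (∃ R S : ℕ × ℕ → ℕ,
      IsSBT (RotheD n (Fin.revPerm : Equiv.Perm (Fin n))) R ∧
      IsSBT (RotheD n (Fin.revPerm : Equiv.Perm (Fin n))) S ∧
      ∀ m : ℕ, ∀ f : ℕ → (ℕ × ℕ → ℕ), f 0 = R →
        (∀ k < m, CMoveT (RotheD n (Fin.revPerm : Equiv.Perm (Fin n))) (f k) (f (k + 1))) →
        (∀ x ∈ RotheD n (Fin.revPerm : Equiv.Perm (Fin n)), f m x = S x) →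
        (n - 2) * (n - 1) * n * (3 * n - 5) / 24 ≤ m) := by
  have e := CoxDiam.flats_card n
  rw [← e]
  constructor
  · intro R S hR hS
    have hR' := CoxDiam.val_of_sbt hR
    obtain ⟨m, hm, hp⟩ := CoxDiam.upper hR' (CoxDiam.val_of_sbt hS)
    exact ⟨m, hm, CoxDiam.real_path hR' hp (fun _ _ => rfl)⟩
  · have hv := CoxDiam.R0_val n
    refine ⟨CoxDiam.R0 n, CoxDiam.op n (CoxDiam.R0 n), CoxDiam.sbt_of_val hv,
      CoxDiam.sbt_of_val (CoxDiam.op_val hv), ?_⟩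
    intro m f h0 h1 h2
    have h3 := (CoxDiam.lower h0 h1 m le_rfl).2
    rw [CoxDiam.inv_congr h2] at h3
    have h4 := CoxDiam.inv_op hv
    rw [CoxDiam.inv_R0] at h4
    omega
end
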